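/- arXiv:2512.20562 — 3 statements merged into one kernel-verified Lean document; each statement's English description precedes it below -/
import Mathlib

section
/- (Local Rademacher complexity of the perturbed RKHS ball.) Let (X, μ) be a probability space, (e_q)_{q≥1} a sequence of measurable functions orthonormal in L²(μ), and (λ_q)_{q≥1} a nonincreasing sequence of nonnegative reals with Σ_q λ_q < ∞ and Σ_q λ_q e_q(x)² < ∞ for every x ∈ X. For B, w > 0 define the function class F(B,w) := { f : X → ℝ : f = h + e, where h(x) = Σ_q β_q √λ_q e_q(x) for some (β_q) with Σ_q β_q² ≤ B², and sup_{x∈X} |e(x)| ≤ w }. Let x₁,…,xₙ be i.i.d. samples from μ and σ₁,…,σₙ i.i.d. Rademacher variables independent of the sample. Then for every r > 0: E[ sup { (1/n) Σ_{i=1}^n σ_i f(x_i) : f ∈ F(B,w), ∫ f² dμ ≤ r } ] ≤ min_{Q ∈ ℕ, Q ≥ 0} ( (√r + w) √(Q/n) + B √( (Σ_{q > Q} λ_q)/n ) ) + w. -/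
open MeasureTheory

/-- The real sign encoded by a Boolean. -/
def boolSign (b : Bool) : ℝ := if b then 1 else -1

lemma boolSign_mul_self (b : Bool) : boolSign b * boolSign b = 1 := by
  cases b <;> simp [boolSign]

lemma boolSign_not (b : Bool) : boolSign (!b) = -boolSign b := by
  cases b <;> simp [boolSign]

lemma abs_boolSign (b : Bool) : |boolSign b| = 1 := by
  cases b <;> simp [boolSign]

lemma sum_boolSign_mul_boolSign {n : ℕ} (i j : Fin n) :
    ∑ s : Fin n → Bool, boolSign (s i) * boolSign (s j) = if i = j then (2 : ℝ) ^ n else 0 := by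
  split_ifs with h
  · subst h
    simp [boolSign_mul_self]
  · refine Finset.sum_involution (fun s _ => Function.update s i (!s i)) ?_ ?_ ?_ ?_
    · intro s _
      simp [Function.update_of_ne (Ne.symm h), boolSign_not]
    · intro s _ _ hs
      simpa using congrFun hs i
    · simp
    · intro s _
      simp

/-- Rademacher averages of squared signed sums. -/
lemma sum_sq_sum_boolSign_mul {n : ℕ} (a : Fin n → ℝ) :
    ∑ s : Fin n → Bool, (∑ i, boolSign (s i) * a i) ^ 2 = 2 ^ n * ∑ i, a i ^ 2 := by
  have h (s : Fin n → Bool) : (∑ i, boolSign (s i) * a i) ^ 2 =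
      ∑ i, ∑ j, a i * a j * (boolSign (s i) * boolSign (s j)) := by
    rw [sq, Finset.sum_mul_sum]
    exact Finset.sum_congr rfl fun i _ => Finset.sum_congr rfl fun j _ => by ring
  simp_rw [h]
  rw [Finset.sum_comm, Finset.mul_sum]
  refine Finset.sum_congr rfl fun i _ => ?_
  rw [Finset.sum_comm]
  simp_rw [← Finset.mul_sum, sum_boolSign_mul_boolSign]
  simp
  ring

lemma sq_sum_boolSign_mul_le {n : ℕ} (s : Fin n → Bool) (a : Fin n → ℝ) :
    (∑ i, boolSign (s i) * a i) ^ 2 ≤ n * ∑ i, a i ^ 2 := by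
  have h := sq_sum_le_card_mul_sum_sq (s := Finset.univ) (f := fun i => boolSign (s i) * a i)
  simpa [mul_pow, sq (boolSign _), boolSign_mul_self] using h

lemma summable_sq_sum_boolSign_mul {n : ℕ} {ι : Type*} {g : ι → Fin n → ℝ}
    (hg : ∀ i, Summable fun q => g q i ^ 2) (s : Fin n → Bool) :
    Summable fun q => (∑ i, boolSign (s i) * g q i) ^ 2 :=
  Summable.of_nonneg_of_le (fun _ => sq_nonneg _) (fun q => sq_sum_boolSign_mul_le s (g q))
    ((summable_sum fun i _ => hg i).mul_left _)

/-- Jensen's inequality for the Rademacher average of the `ℓ²` norm of signed sums. -/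
lemma average_sqrt_tsum_sq_le {n : ℕ} {ι : Type*} {g : ι → Fin n → ℝ}
    (hg : ∀ i, Summable fun q => g q i ^ 2) :
    ((2 : ℝ) ^ n)⁻¹ * ∑ s : Fin n → Bool, √(∑' q, (∑ i, boolSign (s i) * g q i) ^ 2) ≤
      √(∑ i, ∑' q, g q i ^ 2) := by
  have hsum : ∑ s : Fin n → Bool, ∑' q, (∑ i, boolSign (s i) * g q i) ^ 2 =
      2 ^ n * ∑ i, ∑' q, g q i ^ 2 := by
    rw [← Summable.tsum_finsetSum fun s _ => summable_sq_sum_boolSign_mul hg s,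
      ← Summable.tsum_finsetSum fun i _ => hg i, ← tsum_mul_left]
    exact tsum_congr fun q => sum_sq_sum_boolSign_mul (g q)
  apply Real.le_sqrt_of_sq_le
  have h := sq_sum_le_card_mul_sum_sq (s := Finset.univ)
    (f := fun s : Fin n → Bool => √(∑' q, (∑ i, boolSign (s i) * g q i) ^ 2))
  simp only [Real.sq_sqrt (tsum_nonneg fun _ => sq_nonneg _), hsum, Finset.card_univ,
    Fintype.card_fun, Fintype.card_bool, Fintype.card_fin, Nat.cast_pow, Nat.cast_ofNat] at h
  rw [mul_pow]
  calc _ ≤ (((2 : ℝ) ^ n)⁻¹) ^ 2 * (2 ^ n * (2 ^ n * ∑ i, ∑' q, g q i ^ 2)) := by gcongr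
    _ = _ := by field_simp

lemma abs_mul_le_add_sq (a b : ℝ) : |a * b| ≤ a ^ 2 + b ^ 2 := by
  rw [abs_mul, ← sq_abs a, ← sq_abs b]
  nlinarith [sq_nonneg (|a| - |b|), sq_nonneg (|a|), sq_nonneg (|b|)]

lemma summable_mul_of_summable_sq {ι : Type*} {a b : ι → ℝ}
    (ha : Summable fun q => a q ^ 2) (hb : Summable fun q => b q ^ 2) :
    Summable fun q => a q * b q :=
  (ha.add hb).of_norm_bounded fun q => abs_mul_le_add_sq (a q) (b q)

lemma sq_sum_mul_le_tsum {ι : Type*} {a b : ι → ℝ} (ha : Summable fun q => a q ^ 2)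
    (hb : Summable fun q => b q ^ 2) (t : Finset ι) :
    (∑ q ∈ t, a q * b q) ^ 2 ≤ (∑' q, a q ^ 2) * ∑' q, b q ^ 2 :=
  (Finset.sum_mul_sq_le_sq_mul_sq t a b).trans
    (mul_le_mul (ha.sum_le_tsum t fun _ _ => sq_nonneg _)
      (hb.sum_le_tsum t fun _ _ => sq_nonneg _) (Finset.sum_nonneg fun _ _ => sq_nonneg _)
      (tsum_nonneg fun _ => sq_nonneg _))

/-- Cauchy–Schwarz for square-summable families. -/
lemma sq_tsum_mul_le {ι : Type*} {a b : ι → ℝ} (ha : Summable fun q => a q ^ 2)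
    (hb : Summable fun q => b q ^ 2) :
    (∑' q, a q * b q) ^ 2 ≤ (∑' q, a q ^ 2) * ∑' q, b q ^ 2 :=
  le_of_tendsto ((summable_mul_of_summable_sq ha hb).hasSum.pow 2)
    (Filter.Eventually.of_forall fun t => sq_sum_mul_le_tsum ha hb t)

lemma tsum_mul_le_sqrt_mul_sqrt {ι : Type*} {a b : ι → ℝ}
    (ha : Summable fun q => a q ^ 2) (hb : Summable fun q => b q ^ 2) :
    ∑' q, a q * b q ≤ √(∑' q, a q ^ 2) * √(∑' q, b q ^ 2) := by
  rw [← Real.sqrt_mul (tsum_nonneg fun _ => sq_nonneg _)]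
  exact Real.le_sqrt_of_sq_le (sq_tsum_mul_le ha hb)

section Integral

variable {X : Type*} [MeasurableSpace X] {μ : Measure X}

lemma integrable_sqrt_of_nonneg [IsFiniteMeasure μ] {f : X → ℝ} (hf : Integrable f μ)
    (hf0 : ∀ x, 0 ≤ f x) : Integrable (fun x => √(f x)) μ := by
  refine ((integrable_const (1 : ℝ)).add hf).mono'
    hf.aestronglyMeasurable.aemeasurable.sqrt.aestronglyMeasurable
    (Filter.Eventually.of_forall fun x => ?_)
  rw [Real.norm_of_nonneg (Real.sqrt_nonneg _)]
  simp only [Pi.add_apply]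
  nlinarith [Real.sq_sqrt (hf0 x), sq_nonneg (√(f x) - 1), Real.sqrt_nonneg (f x)]

lemma integral_sqrt_le_sqrt_integral [IsProbabilityMeasure μ] {f : X → ℝ} (hf : Integrable f μ)
    (hf0 : ∀ x, 0 ≤ f x) : ∫ x, √(f x) ∂μ ≤ √(∫ x, f x ∂μ) :=
  Real.strictConcaveOn_sqrt.concaveOn.le_map_integral Real.continuous_sqrt.continuousOn isClosed_Ici
    (Filter.Eventually.of_forall hf0) hf (integrable_sqrt_of_nonneg hf hf0)

lemma measurable_tsum_of_summable {ι : Type*} [Countable ι] {g : ι → X → ℝ}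
    (hg : ∀ q, Measurable (g q)) (hs : ∀ x, Summable fun q => g q x) :
    Measurable fun x => ∑' q, g q x :=
  measurable_of_tendsto_metrizable' Filter.atTop
    (f := fun (t : Finset ι) x => ∑ q ∈ t, g q x)
    (fun t => Finset.measurable_sum t fun q _ => hg q)
    (tendsto_pi_nhds.2 fun x => (hs x).hasSum)

lemma integrable_tsum_of_nonneg {ι : Type*} [Countable ι] {g : ι → X → ℝ}
    (hg : ∀ q, Measurable (g q)) (hg0 : ∀ q x, 0 ≤ g q x) (hs : ∀ x, Summable fun q => g q x)
    (hint : ∀ q, Integrable (g q) μ) (hsum : Summable fun q => ∫ x, g q x ∂μ) :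
    Integrable (fun x => ∑' q, g q x) μ := by
  refine ⟨(measurable_tsum_of_summable hg hs).aestronglyMeasurable, ?_⟩
  rw [hasFiniteIntegral_iff_ofReal
    (Filter.Eventually.of_forall fun x => tsum_nonneg fun q => hg0 q x)]
  simp_rw [fun x => ENNReal.ofReal_tsum_of_nonneg (fun q => hg0 q x) (hs x)]
  rw [lintegral_tsum fun q => (hg q).ennreal_ofReal.aemeasurable]
  simp_rw [fun q => (ofReal_integral_eq_lintegral_ofReal (hint q)
    (Filter.Eventually.of_forall (hg0 q))).symm]
  rw [← ENNReal.ofReal_tsum_of_nonneg (fun q => integral_nonneg (hg0 q)) hsum]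
  exact ENNReal.ofReal_lt_top

lemma integral_tsum_of_nonneg {ι : Type*} [Countable ι] {g : ι → X → ℝ}
    (hg0 : ∀ q x, 0 ≤ g q x)
    (hint : ∀ q, Integrable (g q) μ) (hsum : Summable fun q => ∫ x, g q x ∂μ) :
    ∫ x, ∑' q, g q x ∂μ = ∑' q, ∫ x, g q x ∂μ := by
  refine (hasSum_integral_of_summable_integral_norm hint ?_).tsum_eq.symm
  simpa only [fun q x => Real.norm_of_nonneg (hg0 q x)] using hsum

lemma integrable_sum_comp_eval [IsProbabilityMeasure μ] (n : ℕ) {k : X → ℝ}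
    (hk : Integrable k μ) :
    Integrable (fun xs : Fin n → X => ∑ i, k (xs i)) (Measure.pi fun _ => μ) :=
  integrable_finsetSum _ fun _ _ => integrable_comp_eval (μ := fun _ : Fin n => μ) hk

/-- Jensen's inequality for an i.i.d. sum of nonnegative variables. -/
lemma integral_sqrt_sum_comp_eval_le [IsProbabilityMeasure μ] (n : ℕ) {k : X → ℝ}
    (hk : Integrable k μ) (hk0 : ∀ x, 0 ≤ k x) :
    ∫ xs : Fin n → X, √(∑ i, k (xs i)) ∂(Measure.pi fun _ => μ) ≤ √(n * ∫ x, k x ∂μ) := by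
  refine (integral_sqrt_le_sqrt_integral (integrable_sum_comp_eval n hk)
    fun xs => Finset.sum_nonneg fun i _ => hk0 _).trans_eq ?_
  rw [integral_finsetSum _ fun i _ => integrable_comp_eval (μ := fun _ : Fin n => μ) hk]
  simp_rw [integral_comp_eval (μ := fun _ : Fin n => μ) hk.aestronglyMeasurable]
  simp

/-- The triangle inequality in `L²` for a uniformly bounded perturbation. -/
lemma integral_sq_le_of_perturbation [IsProbabilityMeasure μ] {h err : X → ℝ} {w r : ℝ}
    (hw : 0 ≤ w) (hh : MemLp h 2 μ) (herr : Measurable err) (hb : ∀ x, |err x| ≤ w)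
    (hr : ∫ x, (h x + err x) ^ 2 ∂μ ≤ r) : ∫ x, h x ^ 2 ∂μ ≤ (√r + w) ^ 2 := by
  have hE : MemLp err 2 μ := MemLp.of_bound herr.aestronglyMeasurable w
    (Filter.Eventually.of_forall hb)
  have hu : MemLp (fun x => h x + err x) 2 μ := hh.add hE
  have husq := hu.integrable_sq
  have huabs : Integrable (fun x => |h x + err x|) μ := (hu.integrable one_le_two).abs
  have hr0 : 0 ≤ r := (integral_nonneg fun x => sq_nonneg _).trans hr
  have hL1 : ∫ x, |h x + err x| ∂μ ≤ √r := by
    have := integral_sqrt_le_sqrt_integral husq fun x => sq_nonneg _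
    simp only [Real.sqrt_sq_eq_abs] at this
    exact this.trans (Real.sqrt_le_sqrt hr)
  calc ∫ x, h x ^ 2 ∂μ ≤ ∫ x, ((h x + err x) ^ 2 + 2 * w * |h x + err x| + w ^ 2) ∂μ := by
        refine integral_mono hh.integrable_sq
          ((husq.add (huabs.const_mul _)).add (integrable_const _)) fun x => ?_
        have h1 : |h x| ≤ |h x + err x| + w := by
          have := abs_sub (h x + err x) (err x)
          rw [add_sub_cancel_right] at this
          linarith [hb x]
        have h2 : |h x| ^ 2 ≤ (|h x + err x| + w) ^ 2 := by gcongr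
        rw [sq_abs] at h2
        simp only
        nlinarith [sq_abs (h x + err x)]
    _ = ∫ x, (h x + err x) ^ 2 ∂μ + 2 * w * ∫ x, |h x + err x| ∂μ + w ^ 2 := by
        have hc := huabs.const_mul (2 * w)
        rw [integral_add (f := fun x => (h x + err x) ^ 2 + 2 * w * |h x + err x|)
          (husq.add hc) (integrable_const _), integral_add husq hc, integral_const_mul]
        simp
    _ ≤ r + 2 * w * √r + w ^ 2 := by gcongr
    _ = (√r + w) ^ 2 := by linear_combination -(Real.sq_sqrt hr0)

section Expansion

variable {φ : ℕ → X → ℝ} {lam : ℕ → ℝ} {β : ℕ → ℝ}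

lemma integral_sq_sum_range_of_orthogonal
    (hφL2 : ∀ q, MemLp (φ q) 2 μ)
    (horth : ∀ q q', ∫ x, φ q x * φ q' x ∂μ = if q = q' then lam q else 0) (N : ℕ) :
    ∫ x, (∑ q ∈ Finset.range N, β q * φ q x) ^ 2 ∂μ =
      ∑ q ∈ Finset.range N, β q ^ 2 * lam q := by
  have hint (q q' : ℕ) : Integrable (fun x => φ q x * φ q' x) μ :=
    (hφL2 q).integrable_mul (hφL2 q')
  have hexp (x : X) : (∑ q ∈ Finset.range N, β q * φ q x) ^ 2 =
      ∑ q ∈ Finset.range N, ∑ q' ∈ Finset.range N, β q * β q' * (φ q x * φ q' x) := by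
    rw [sq, Finset.sum_mul_sum]
    exact Finset.sum_congr rfl fun q _ => Finset.sum_congr rfl fun q' _ => by ring
  simp_rw [hexp]
  rw [integral_finsetSum _ fun q _ => integrable_finsetSum _ fun q' _ => (hint q q').const_mul _]
  refine Finset.sum_congr rfl fun q hq => ?_
  rw [integral_finsetSum _ fun q' _ => (hint q q').const_mul _]
  simp_rw [integral_const_mul, horth]
  simp only [mul_ite, mul_zero, Finset.sum_ite_eq, hq, if_true]
  ring

lemma memLp_two_tsum_mul (hφ : ∀ q, Measurable (φ q))
    (hφs : ∀ x, Summable fun q => φ q x ^ 2)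
    (hK : Integrable (fun x => ∑' q, φ q x ^ 2) μ) (hβ : Summable fun q => β q ^ 2) :
    MemLp (fun x => ∑' q, β q * φ q x) 2 μ := by
  have hm : Measurable fun x => ∑' q, β q * φ q x :=
    measurable_tsum_of_summable (fun q => (hφ q).const_mul _)
      fun x => summable_mul_of_summable_sq hβ (hφs x)
  rw [memLp_two_iff_integrable_sq hm.aestronglyMeasurable]
  refine (hK.const_mul (∑' q, β q ^ 2)).mono' (hm.pow_const 2).aestronglyMeasurable
    (Filter.Eventually.of_forall fun x => ?_)
  rw [Real.norm_of_nonneg (sq_nonneg _)]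
  exact sq_tsum_mul_le hβ (hφs x)

/-- Bessel's inequality for a pointwise convergent orthogonal expansion. -/
lemma sum_range_sq_mul_le_integral_sq (hφ : ∀ q, Measurable (φ q))
    (hφs : ∀ x, Summable fun q => φ q x ^ 2) (hφL2 : ∀ q, MemLp (φ q) 2 μ)
    (horth : ∀ q q', ∫ x, φ q x * φ q' x ∂μ = if q = q' then lam q else 0)
    (hlam : ∀ q, 0 ≤ lam q)
    (hK : Integrable (fun x => ∑' q, φ q x ^ 2) μ) (hβ : Summable fun q => β q ^ 2) (Q : ℕ) :
    ∑ q ∈ Finset.range Q, β q ^ 2 * lam q ≤ ∫ x, (∑' q, β q * φ q x) ^ 2 ∂μ := by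
  have hlim : Filter.Tendsto
      (fun N => ∫ x, (∑ q ∈ Finset.range N, β q * φ q x) ^ 2 ∂μ) Filter.atTop
      (nhds (∫ x, (∑' q, β q * φ q x) ^ 2 ∂μ)) := by
    refine tendsto_integral_of_dominated_convergence
      (fun x => (∑' q, β q ^ 2) * ∑' q, φ q x ^ 2) (fun N => ?_) (hK.const_mul _)
      (fun N => Filter.Eventually.of_forall fun x => ?_)
      (Filter.Eventually.of_forall fun x => ?_)
    · exact ((Finset.measurable_sum _ fun q _ =>
        (hφ q).const_mul (β q)).pow_const 2).aestronglyMeasurable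
    · rw [Real.norm_of_nonneg (sq_nonneg _)]
      exact sq_sum_mul_le_tsum hβ (hφs x) _
    · exact (summable_mul_of_summable_sq hβ (hφs x)).hasSum.tendsto_sum_nat.pow 2
  refine ge_of_tendsto hlim ((Filter.eventually_ge_atTop Q).mono fun N hN => ?_)
  rw [integral_sq_sum_range_of_orthogonal hφL2 horth]
  exact Finset.sum_le_sum_of_subset_of_nonneg (Finset.range_mono hN)
    fun q _ _ => mul_nonneg (sq_nonneg _) (hlam q)

end Expansion

end Integral

/-- Splitting the signed empirical sum of `h + err` into head, tail and perturbation. -/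
lemma sum_boolSign_mul_tsum_add_le {n : ℕ} (s : Fin n → Bool) {a : ℕ → Fin n → ℝ}
    {lam β : ℕ → ℝ} {err : Fin n → ℝ} {B R w : ℝ} (hB : 0 ≤ B) (hR : 0 ≤ R)
    (hlam : ∀ q, 0 ≤ lam q) (ha : ∀ i, Summable fun q => lam q * a q i ^ 2)
    (hβ : Summable fun q => β q ^ 2) (hβB : ∑' q, β q ^ 2 ≤ B ^ 2)
    (herr : ∀ i, |err i| ≤ w) (Q : ℕ)
    (hhead : ∑ q ∈ Finset.range Q, β q ^ 2 * lam q ≤ R ^ 2) :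
    ∑ i, boolSign (s i) * ((∑' q, β q * √(lam q) * a q i) + err i) ≤
      R * √(∑' q : Fin Q, (∑ i, boolSign (s i) * a q i) ^ 2) +
      B * √(∑' q, (∑ i, boolSign (s i) * (√(lam (Q + q)) * a (Q + q) i)) ^ 2) + n * w := by
  have hφs (i : Fin n) : Summable fun q => (√(lam q) * a q i) ^ 2 := by
    simpa only [mul_pow, Real.sq_sqrt (hlam _)] using ha i
  have hs (i : Fin n) : Summable fun q => β q * √(lam q) * a q i := by
    simpa only [mul_assoc] using summable_mul_of_summable_sq hβ (hφs i)
  have hshift {f : ℕ → ℝ} (hf : Summable f) : Summable fun q => f (Q + q) := by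
    simpa only [add_comm Q] using (summable_nat_add_iff Q).2 hf
  have hz := summable_sq_sum_boolSign_mul (g := fun q i => √(lam (Q + q)) * a (Q + q) i)
    (fun i => hshift (hφs i)) s
  have hsplit : ∑ i, boolSign (s i) * ((∑' q, β q * √(lam q) * a q i) + err i) =
      (∑' q : Fin Q, (β q * √(lam q)) * ∑ i, boolSign (s i) * a q i) +
      (∑' q, β (Q + q) * ∑ i, boolSign (s i) * (√(lam (Q + q)) * a (Q + q) i)) +
      ∑ i, boolSign (s i) * err i := by
    have h1 (i : Fin n) : ∑' q, β q * √(lam q) * a q i =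
        (∑' q : Fin Q, β q * √(lam q) * a q i) +
          ∑' q, β (Q + q) * √(lam (Q + q)) * a (Q + q) i := by
      rw [← (hs i).sum_add_tsum_nat_add Q, tsum_fintype (L := SummationFilter.unconditional (Fin Q)),
        Fin.sum_univ_eq_sum_range (fun q => β q * √(lam q) * a q i)]
      simp only [add_comm Q]
    simp_rw [h1, mul_add, Finset.sum_add_distrib, tsum_fintype, Finset.mul_sum]
    congr 2
    · rw [Finset.sum_comm]
      exact Finset.sum_congr rfl fun q _ => Finset.sum_congr rfl fun i _ => by ring
    · simp_rw [← tsum_mul_left]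
      rw [← Summable.tsum_finsetSum fun i _ => (hshift (hs i)).mul_left _]
      exact tsum_congr fun q => Finset.sum_congr rfl fun i _ => by ring
  rw [hsplit]
  gcongr ?_ + ?_ + ?_
  · refine (tsum_mul_le_sqrt_mul_sqrt Summable.of_finite Summable.of_finite).trans ?_
    gcongr
    rw [tsum_fintype, Fin.sum_univ_eq_sum_range (fun q => (β q * √(lam q)) ^ 2)]
    simp_rw [mul_pow, Real.sq_sqrt (hlam _)]
    exact Real.sqrt_le_iff.2 ⟨hR, hhead⟩
  · refine (tsum_mul_le_sqrt_mul_sqrt (hshift hβ) hz).trans ?_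
    gcongr
    refine Real.sqrt_le_iff.2 ⟨hB, le_trans ?_ hβB⟩
    rw [← hβ.sum_add_tsum_nat_add Q]
    simp only [add_comm Q]
    exact le_add_of_nonneg_left (Finset.sum_nonneg fun _ _ => sq_nonneg _)
  · calc ∑ i, boolSign (s i) * err i ≤ ∑ _i : Fin n, w :=
          Finset.sum_le_sum fun i _ => (le_abs_self _).trans (by
            rw [abs_mul, abs_boolSign, one_mul]; exact herr i)
      _ = n * w := by simp

/-- Local Rademacher complexity of the perturbed RKHS ball: for the class
`F(B,w) = {h + e : h in the radius-`B` RKHS ball of the Mercer kernel with eigenfunctions `e_q`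
and eigenvalues `λ_q`, sup|e| ≤ w}`, for every `r > 0` and every cut-off `Q`,
`E[ sup { (1/n) Σᵢ σᵢ f(xᵢ) : f ∈ F(B,w), ∫ f² dμ ≤ r } ]
  ≤ (√r + w)√(Q/n) + B √((Σ_{q>Q} λ_q)/n) + w`
(the expectation is over the i.i.d. sample `x₁,…,xₙ ∼ μ` and independent uniform Rademacher
signs, here realized as an average over all sign vectors). -/
theorem local_rademacher_perturbed_rkhs_ball
    {X : Type*} [MeasurableSpace X] (μ : Measure X) [IsProbabilityMeasure μ]
    (e : ℕ → X → ℝ) (hmeas : ∀ q, Measurable (e q))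
    (horth : ∀ q q', ∫ x, e q x * e q' x ∂μ = if q = q' then 1 else 0)
    (lam : ℕ → ℝ) (hlam0 : ∀ q, 0 ≤ lam q) (hmono : ∀ q q', q ≤ q' → lam q' ≤ lam q)
    (hsum : Summable lam) (hptsum : ∀ x, Summable fun q => lam q * e q x ^ 2)
    (B w : ℝ) (hB : 0 < B) (hw : 0 < w)
    (n : ℕ) (hn : 0 < n) (r : ℝ) (hr : 0 < r) :
    ∀ Q : ℕ,
      (∫⁻ xs : Fin n → X,
          ENNReal.ofReal
            (((2 : ℝ) ^ n)⁻¹ *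
              ∑ s : Fin n → Bool,
                sSup {t : ℝ | ∃ (β : ℕ → ℝ) (err : X → ℝ),
                  Summable (fun q => β q ^ 2) ∧ (∑' q, β q ^ 2) ≤ B ^ 2 ∧
                  Measurable err ∧ (∀ x, |err x| ≤ w) ∧
                  (∫ x, ((∑' q, β q * Real.sqrt (lam q) * e q x) + err x) ^ 2 ∂μ ≤ r) ∧
                  t = (n : ℝ)⁻¹ * ∑ i : Fin n,
                    (if s i then (1 : ℝ) else -1) *
                      ((∑' q, β q * Real.sqrt (lam q) * e q (xs i)) + err (xs i))})
          ∂(Measure.pi fun _ : Fin n => μ)) ≤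
        ENNReal.ofReal
          ((Real.sqrt r + w) * Real.sqrt (Q / n) +
            B * Real.sqrt ((∑' q : ℕ, lam (Q + q)) / n) + w) := by
  intro Q
  have hsq1 (q : ℕ) : ∫ x, e q x ^ 2 ∂μ = 1 := by
    simpa [sq] using horth q q
  have heint (q : ℕ) : Integrable (fun x => e q x ^ 2) μ :=
    Integrable.of_integral_ne_zero (by rw [hsq1]; exact one_ne_zero)
  set φ : ℕ → X → ℝ := fun q x => √(lam q) * e q x with hφdef
  have hφsq (q : ℕ) (x : X) : φ q x ^ 2 = lam q * e q x ^ 2 := by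
    rw [hφdef, mul_pow, Real.sq_sqrt (hlam0 q)]
  have hφm (q : ℕ) : Measurable (φ q) := (hmeas q).const_mul _
  have hφs (x : X) : Summable fun q => φ q x ^ 2 := by simpa only [hφsq] using hptsum x
  have hφint (q : ℕ) : Integrable (fun x => φ q x ^ 2) μ := by
    simpa only [hφsq] using (heint q).const_mul (lam q)
  have hφL2 (q : ℕ) : MemLp (φ q) 2 μ :=
    (memLp_two_iff_integrable_sq (hφm q).aestronglyMeasurable).2 (hφint q)
  have hφI (q : ℕ) : ∫ x, φ q x ^ 2 ∂μ = lam q := by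
    simp_rw [hφsq, integral_const_mul, hsq1, mul_one]
  have hφorth (q q' : ℕ) : ∫ x, φ q x * φ q' x ∂μ = if q = q' then lam q else 0 := by
    have h1 (x : X) : φ q x * φ q' x = √(lam q) * √(lam q') * (e q x * e q' x) := by
      simp only [hφdef]; ring
    simp_rw [h1, integral_const_mul, horth]
    split_ifs with h
    · rw [← h, Real.mul_self_sqrt (hlam0 q), mul_one]
    · rw [mul_zero]
  have hK : Integrable (fun x => ∑' q, φ q x ^ 2) μ :=
    integrable_tsum_of_nonneg (fun q => (hφm q).pow_const 2) (fun _ _ => sq_nonneg _) hφs hφint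
      (by simpa only [hφI] using hsum)
  have hshift {f : ℕ → ℝ} (hf : Summable f) : Summable fun q => f (Q + q) := by
    simpa only [add_comm Q] using (summable_nat_add_iff Q).2 hf
  have hK1 : Integrable (fun x => ∑' q : Fin Q, e q x ^ 2) μ := by
    simp_rw [tsum_fintype]
    exact integrable_finsetSum _ fun q _ => heint q
  have hI1 : ∫ x, ∑' q : Fin Q, e q x ^ 2 ∂μ = Q := by
    simp_rw [tsum_fintype]
    rw [integral_finsetSum _ fun (q : Fin Q) _ => heint q]
    simp [hsq1]
  have hsumI : Summable fun q => ∫ x, φ (Q + q) x ^ 2 ∂μ := by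
    simpa only [hφI] using hshift hsum
  have hK2 : Integrable (fun x => ∑' q, φ (Q + q) x ^ 2) μ :=
    integrable_tsum_of_nonneg (fun q => (hφm (Q + q)).pow_const 2) (fun _ _ => sq_nonneg _)
      (fun x => hshift (hφs x)) (fun q => hφint (Q + q)) hsumI
  have hI2 : ∫ x, ∑' q, φ (Q + q) x ^ 2 ∂μ = ∑' q, lam (Q + q) := by
    rw [integral_tsum_of_nonneg (fun _ _ => sq_nonneg _) (fun q => hφint (Q + q)) hsumI]
    simp_rw [hφI]
  have hR : 0 ≤ √r + w := by positivity
  have hn' : (0 : ℝ) < n := Nat.cast_pos.2 hn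
  set A : (Fin n → X) → ℝ := fun xs => √(∑ i, ∑' q : Fin Q, e q (xs i) ^ 2) with hA
  set T : (Fin n → X) → ℝ := fun xs => √(∑ i, ∑' q, φ (Q + q) (xs i) ^ 2) with hT
  have hbound (xs : Fin n → X) (s : Fin n → Bool) :
      sSup {t : ℝ | ∃ (β : ℕ → ℝ) (err : X → ℝ),
        Summable (fun q => β q ^ 2) ∧ (∑' q, β q ^ 2) ≤ B ^ 2 ∧
        Measurable err ∧ (∀ x, |err x| ≤ w) ∧
        (∫ x, ((∑' q, β q * Real.sqrt (lam q) * e q x) + err x) ^ 2 ∂μ ≤ r) ∧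
        t = (n : ℝ)⁻¹ * ∑ i : Fin n,
          (if s i then (1 : ℝ) else -1) *
            ((∑' q, β q * Real.sqrt (lam q) * e q (xs i)) + err (xs i))} ≤
      (n : ℝ)⁻¹ * ((√r + w) * √(∑' q : Fin Q, (∑ i, boolSign (s i) * e q (xs i)) ^ 2) +
        B * √(∑' q, (∑ i, boolSign (s i) * φ (Q + q) (xs i)) ^ 2) + n * w) := by
    refine Real.sSup_le ?_ (by positivity)
    rintro t ⟨β, err, hβ, hβB, herrm, herr, hfr, rfl⟩
    refine mul_le_mul_of_nonneg_left ?_ (by positivity)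
    refine sum_boolSign_mul_tsum_add_le s (a := fun q i => e q (xs i)) hB.le hR hlam0
      (fun i => hptsum (xs i)) hβ hβB (fun i => herr (xs i)) Q ?_
    refine (sum_range_sq_mul_le_integral_sq hφm hφs hφL2 hφorth hlam0 hK hβ Q).trans
      (integral_sq_le_of_perturbation hw.le (memLp_two_tsum_mul hφm hφs hK hβ) herrm herr ?_)
    simpa only [hφdef, mul_assoc] using hfr
  have hpoint (xs : Fin n → X) := by
    have hsum_le := Finset.sum_le_sum fun s (_ : s ∈ Finset.univ) => hbound xs s
    have h1 := average_sqrt_tsum_sq_le (g := fun (q : Fin Q) i => e q (xs i))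
      fun _ => Summable.of_finite
    have h2 := average_sqrt_tsum_sq_le (g := fun q i => φ (Q + q) (xs i))
      fun i => hshift (hφs (xs i))
    have h3 := mul_le_mul_of_nonneg_left hsum_le (by positivity : 0 ≤ ((2 : ℝ) ^ n)⁻¹)
    refine h3.trans (?_ : _ ≤ (n : ℝ)⁻¹ * ((√r + w) * A xs + B * T xs) + w)
    rw [← Finset.mul_sum, Finset.sum_add_distrib, Finset.sum_add_distrib, ← Finset.mul_sum,
      ← Finset.mul_sum]
    have h4 := mul_le_mul_of_nonneg_left (add_le_add (mul_le_mul_of_nonneg_left h1 hR)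
      (mul_le_mul_of_nonneg_left h2 hB.le)) (inv_nonneg.2 hn'.le)
    refine le_trans (le_of_eq ?_) (add_le_add_left h4 w)
    simp only [Finset.sum_const, Finset.card_univ, Fintype.card_fun, Fintype.card_bool,
      Fintype.card_fin, nsmul_eq_mul, Nat.cast_pow, Nat.cast_ofNat]
    field_simp
  have hAint : Integrable A (Measure.pi fun _ : Fin n => μ) :=
    integrable_sqrt_of_nonneg (integrable_sum_comp_eval n hK1)
      fun xs => Finset.sum_nonneg fun i _ => tsum_nonneg fun q => sq_nonneg _
  have hTint : Integrable T (Measure.pi fun _ : Fin n => μ) :=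
    integrable_sqrt_of_nonneg (integrable_sum_comp_eval n hK2)
      fun xs => Finset.sum_nonneg fun i _ => tsum_nonneg fun q => sq_nonneg _
  have hAle : ∫ xs, A xs ∂(Measure.pi fun _ : Fin n => μ) ≤ √(n * Q) := by
    simpa only [hI1] using
      integral_sqrt_sum_comp_eval_le n hK1 fun x => tsum_nonneg fun q => sq_nonneg _
  have hTle : ∫ xs, T xs ∂(Measure.pi fun _ : Fin n => μ) ≤ √(n * ∑' q, lam (Q + q)) := by
    simpa only [hI2] using
      integral_sqrt_sum_comp_eval_le n hK2 fun x => tsum_nonneg fun q => sq_nonneg _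
  refine (lintegral_mono fun xs => ENNReal.ofReal_le_ofReal (hpoint xs)).trans ?_
  have hATint : Integrable (fun xs => (n : ℝ)⁻¹ * ((√r + w) * A xs + B * T xs))
      (Measure.pi fun _ : Fin n => μ) := ((hAint.const_mul (√r + w)).add (hTint.const_mul B)).const_mul (n : ℝ)⁻¹
  have hATw : Integrable (fun xs => (n : ℝ)⁻¹ * ((√r + w) * A xs + B * T xs) + w)
      (Measure.pi fun _ : Fin n => μ) := hATint.add (integrable_const w)
  rw [← ofReal_integral_eq_lintegral_ofReal hATw
    (Filter.Eventually.of_forall fun xs => by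
      simp only [hA, hT, Pi.zero_apply]; positivity)]
  refine ENNReal.ofReal_le_ofReal ?_
  have hscale (c : ℝ) : (n : ℝ)⁻¹ * √(n * c) = √(c / n) := by
    rw [← Real.sqrt_sq (inv_nonneg.2 hn'.le), ← Real.sqrt_mul (sq_nonneg _)]
    congr 1
    field_simp
  rw [integral_add hATint (integrable_const w), integral_const_mul,
    integral_add (hAint.const_mul _) (hTint.const_mul _), integral_const_mul,
    integral_const_mul, ← hscale, ← hscale]
  simp only [integral_const, probReal_univ, one_smul]
  have h5 := mul_le_mul_of_nonneg_left (add_le_add (mul_le_mul_of_nonneg_left hAle hR)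
      (mul_le_mul_of_nonneg_left hTle hB.le)) (inv_nonneg.2 hn'.le)
  linarith
end

section
/- (Generalization bound for the perturbed finite-rank RKHS ball.) Let (X, μ) be a probability space, (e_q)_{q=1}^{R} measurable functions orthonormal in L²(μ), and λ₁ ≥ … ≥ λ_R > 0 with κ := sup_{x∈X} Σ_{q=1}^R λ_q e_q(x)² < ∞. For B, w > 0 define F(B,w) := { f : X → ℝ : f = h + e, where h(x) = Σ_{q=1}^R β_q √λ_q e_q(x) with Σ_q β_q² ≤ B², and sup_x |e(x)| ≤ w }, and let f*(x) = Σ_{q=1}^R β*_q √λ_q e_q(x) with Σ_q (β*_q)² ≤ γ₀². Assume w ∈ (0,1). Then there is a constant C depending only on B, γ₀ and κ such that for every n ≥ 1 and every x̄ > 0, with probability at least 1 − e^{−x̄} over an i.i.d. sample x₁,…,xₙ from μ, simultaneously for all f ∈ F(B,w): ∫ (f − f*)² dμ ≤ (2/n) Σ_{i=1}^n ( f(x_i) − f*(x_i) )² + C ( R/n + w + x̄/n ). -/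
open MeasureTheory

lemma measureReal_pi_le_sum_le_exp_neg {X : Type*} [MeasurableSpace X] (μ : Measure X)
    [IsProbabilityMeasure μ] (n : ℕ) {φ : X → ℝ} (hi : Integrable (fun x => Real.exp (φ x)) μ)
    (h : ∫ x, Real.exp (φ x) ∂μ ≤ 1) (u : ℝ) :
    (Measure.pi fun _ : Fin n => μ).real {xs | u ≤ ∑ i, φ (xs i)} ≤ Real.exp (-u) := by
  have hI : Integrable (fun xs : Fin n → X => ∏ i, Real.exp (φ (xs i)))
      (Measure.pi fun _ : Fin n => μ) :=
    Integrable.fintype_prod (f := fun (_ : Fin n) x => Real.exp (φ x)) fun _ => hi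
  have hE : ∫ xs : Fin n → X, ∏ i, Real.exp (φ (xs i)) ∂(Measure.pi fun _ : Fin n => μ) ≤ 1 := by
    rw [integral_fintype_prod_eq_pow (fun x => Real.exp (φ x))]
    exact pow_le_one₀ (integral_nonneg fun x => (Real.exp_pos _).le) h
  have hM := mul_meas_ge_le_integral_of_nonneg
    (Filter.Eventually.of_forall fun xs => Finset.prod_nonneg fun i _ => (Real.exp_pos _).le)
    hI (Real.exp u)
  have hS : {xs : Fin n → X | Real.exp u ≤ ∏ i, Real.exp (φ (xs i))}
      = {xs | u ≤ ∑ i, φ (xs i)} := by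
    ext xs
    simp [← Real.exp_sum]
  rw [hS] at hM
  rw [Real.exp_neg, ← one_div, le_div_iff₀ (Real.exp_pos u), mul_comm]
  exact hM.trans hE

lemma exp_neg_le_one_sub {y : ℝ} (h0 : 0 ≤ y) (h1 : y ≤ 1) :
    Real.exp (-y) ≤ 1 - 9 / 16 * y := by
  have h := convexOn_exp.2 (Set.mem_univ 0) (Set.mem_univ (-1)) (sub_nonneg.2 h1) h0 (by ring)
  have he : Real.exp (-1) ≤ 7 / 16 := by linarith [Real.exp_neg_one_lt_d9]
  simp only [smul_eq_mul, mul_zero, zero_add, Real.exp_zero, mul_one, mul_neg] at h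
  nlinarith

lemma exp_le_one_add_two_mul {y : ℝ} (h0 : 0 ≤ y) (h1 : y ≤ 1) :
    Real.exp y ≤ 1 + 2 * y := by
  have h := convexOn_exp.2 (Set.mem_univ 0) (Set.mem_univ 1) (sub_nonneg.2 h1) h0 (by ring)
  have he : Real.exp 1 ≤ 3 := by linarith [Real.exp_one_lt_d9]
  simp only [smul_eq_mul, mul_zero, zero_add, Real.exp_zero, mul_one] at h
  nlinarith

lemma integrable_of_mem_unitInterval {X : Type*} [MeasurableSpace X] (μ : Measure X)
    [IsProbabilityMeasure μ] {f : X → ℝ} (hf : Measurable f) (h0 : ∀ x, 0 ≤ f x)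
    (h1 : ∀ x, f x ≤ 1) : Integrable f μ :=
  Integrable.of_bound hf.aestronglyMeasurable 1
    (.of_forall fun x => by simpa [abs_of_nonneg (h0 x)] using h1 x)

lemma integrable_exp_add_mul {X : Type*} [MeasurableSpace X] (μ : Measure X)
    [IsProbabilityMeasure μ] {f : X → ℝ} (hf : Measurable f) (h0 : ∀ x, 0 ≤ f x)
    (h1 : ∀ x, f x ≤ 1) (a b : ℝ) : Integrable (fun x => Real.exp (a + b * f x)) μ := by
  refine Integrable.of_bound (by fun_prop) (Real.exp (a + |b|)) (.of_forall fun x => ?_)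
  rw [Real.norm_eq_abs, Real.abs_exp, Real.exp_le_exp]
  nlinarith [h0 x, h1 x, abs_nonneg b, le_abs_self b]

lemma integral_exp_sub_le_one {X : Type*} [MeasurableSpace X] (μ : Measure X)
    [IsProbabilityMeasure μ] {f : X → ℝ} (hf : Measurable f) (h0 : ∀ x, 0 ≤ f x)
    (h1 : ∀ x, f x ≤ 1) {p : ℝ} (hp : p ≤ ∫ x, f x ∂μ) :
    ∫ x, Real.exp (9 / 16 * p - f x) ∂μ ≤ 1 := by
  have hi := integrable_of_mem_unitInterval μ hf h0 h1
  calc ∫ x, Real.exp (9 / 16 * p - f x) ∂μ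
      ≤ ∫ x, Real.exp (9 / 16 * p) * (1 - 9 / 16 * f x) ∂μ := by
        refine integral_mono ?_ (((integrable_const _).sub (hi.const_mul _)).const_mul _)
          fun x => ?_
        · simpa [sub_eq_add_neg] using integrable_exp_add_mul μ hf h0 h1 (9 / 16 * p) (-1)
        · simp only [sub_eq_add_neg (9 / 16 * p), Real.exp_add]
          gcongr
          exact exp_neg_le_one_sub (h0 x) (h1 x)
    _ = Real.exp (9 / 16 * p) * (1 - 9 / 16 * ∫ x, f x ∂μ) := by
        rw [integral_const_mul, integral_sub (integrable_const _) (hi.const_mul _),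
          integral_const_mul]
        simp
    _ ≤ Real.exp (9 / 16 * p) * Real.exp (-(9 / 16 * p)) := by
        gcongr
        linarith [Real.add_one_le_exp (-(9 / 16 * p))]
    _ = 1 := by rw [← Real.exp_add]; simp

lemma integral_exp_sub_two_mul_le_one {X : Type*} [MeasurableSpace X] (μ : Measure X)
    [IsProbabilityMeasure μ] {f : X → ℝ} (hf : Measurable f) (h0 : ∀ x, 0 ≤ f x)
    (h1 : ∀ x, f x ≤ 1) {p : ℝ} (hp : ∫ x, f x ∂μ ≤ p) :
    ∫ x, Real.exp (f x - 2 * p) ∂μ ≤ 1 := by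
  have hi := integrable_of_mem_unitInterval μ hf h0 h1
  calc ∫ x, Real.exp (f x - 2 * p) ∂μ
      ≤ ∫ x, Real.exp (-(2 * p)) * (1 + 2 * f x) ∂μ := by
        refine integral_mono ?_ (((integrable_const _).add (hi.const_mul _)).const_mul _)
          fun x => ?_
        · simpa [sub_eq_add_neg, add_comm] using
            integrable_exp_add_mul μ hf h0 h1 (-(2 * p)) 1
        · simp only [sub_eq_add_neg, Real.exp_add, mul_comm (Real.exp (f x))]
          gcongr
          exact exp_le_one_add_two_mul (h0 x) (h1 x)
    _ = Real.exp (-(2 * p)) * (1 + 2 * ∫ x, f x ∂μ) := by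
        rw [integral_const_mul, integral_add (integrable_const _) (hi.const_mul _),
          integral_const_mul]
        simp
    _ ≤ Real.exp (-(2 * p)) * Real.exp (2 * p) := by
        gcongr
        linarith [Real.add_one_le_exp (2 * p)]
    _ = 1 := by rw [← Real.exp_add]; simp

/-- Moving one coordinate of a quadratic form to one of the two neighbouring integers. -/
lemma exists_round_coordinate (a ℓ S τ : ℝ) (ha : -S ≤ a) (hS : 0 ≤ S) :
    ∃ δ : ℝ, (∃ k : ℤ, τ + δ = k) ∧ |δ| ≤ 1 ∧ 0 ≤ 2 * δ * ℓ + δ ^ 2 * a + S / 4 := by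
  have h0 := Int.fract_nonneg τ
  have h1 := (Int.fract_lt_one τ).le
  have hfl := Int.floor_add_fract τ
  set f := Int.fract τ
  by_cases h : 0 ≤ 2 * (-f) * ℓ + (-f) ^ 2 * a + S / 4
  · exact ⟨-f, ⟨⌊τ⌋, by linarith⟩, by rw [abs_neg, abs_of_nonneg h0]; exact h1, h⟩
  · refine ⟨1 - f, ⟨⌊τ⌋ + 1, by push_cast; linarith⟩,
      by rw [abs_of_nonneg (by linarith)]; linarith, ?_⟩
    by_contra h'
    push Not at h h'
    have e1 : (1 - f) * (2 * (-f) * ℓ + (-f) ^ 2 * a + S / 4)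
        + f * (2 * (1 - f) * ℓ + (1 - f) ^ 2 * a + S / 4) = f * (1 - f) * a + S / 4 := by ring
    have e2 : 0 ≤ f * (1 - f) * a + S / 4 := by
      nlinarith [mul_nonneg (mul_nonneg h0 (sub_nonneg.2 h1)) (by linarith : 0 ≤ a + S),
        mul_nonneg hS (sq_nonneg (f - 1 / 2))]
    have e3 : 0 < 1 - f ∨ 0 < f := by
      by_contra hc
      push Not at hc
      linarith [hc.1, hc.2]
    rcases e3 with e3 | e3
    · nlinarith [mul_neg_of_pos_of_neg e3 h, mul_nonpos_of_nonneg_of_nonpos h0 h'.le]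
    · nlinarith [mul_neg_of_pos_of_neg e3 h',
        mul_nonpos_of_nonneg_of_nonpos (sub_nonneg.2 h1) h.le]

lemma exists_round_finset {ι κ : Type*} [Fintype ι] [DecidableEq ι] [Fintype κ]
    (d : ι → ℝ) (hd : ∀ q, 0 ≤ d q) (Y : κ → ι → ℝ) (t : ι → ℝ) (s : Finset ι) :
    ∃ t' : ι → ℝ, (∀ q ∈ s, ∃ k : ℤ, t' q = k) ∧ (∀ q ∉ s, t' q = t q) ∧
      (∀ q, |t' q - t q| ≤ 1) ∧
      ∑ q, d q * t q ^ 2 - ∑ i, (∑ q, t q * Y i q) ^ 2 ≤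
        ∑ q, d q * t' q ^ 2 - ∑ i, (∑ q, t' q * Y i q) ^ 2
          + (∑ q ∈ s, ∑ i, Y i q ^ 2) / 4 := by
  induction s using Finset.induction_on with
  | empty => exact ⟨t, by simp, by simp, by simp, by simp⟩
  | insert r s hr ih =>
    obtain ⟨t', h1, h2, h3, h4⟩ := ih
    obtain ⟨δ, hk, hδ, hq⟩ := exists_round_coordinate (d r - ∑ i, Y i r ^ 2)
      (d r * t' r - ∑ i, (∑ q, t' q * Y i q) * Y i r) (∑ i, Y i r ^ 2) (t' r)
      (by linarith [hd r]) (Finset.sum_nonneg fun i _ => sq_nonneg _)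
    refine ⟨t' + Pi.single r δ, ?_, ?_, ?_, ?_⟩
    · intro q hqs
      by_cases hqr : q = r
      · subst hqr; simpa using hk
      · simpa [hqr] using h1 q (Finset.mem_of_mem_insert_of_ne hqs hqr)
    · intro q hqs
      simp only [Finset.mem_insert, not_or] at hqs
      simpa [hqs.1] using h2 q hqs.2
    · intro q
      by_cases hqr : q = r
      · subst hqr; simpa [h2 q hr] using hδ
      · simpa [hqr] using h3 q
    · have e1 : ∀ i, ∑ q, (t' + Pi.single r δ : ι → ℝ) q * Y i q = (∑ q, t' q * Y i q) + δ * Y i r := by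
        intro i
        simp [add_mul, Finset.sum_add_distrib, Pi.single_apply]
      have e2 : ∑ q, d q * (t' + Pi.single r δ : ι → ℝ) q ^ 2
          = ∑ q, d q * t' q ^ 2 + (2 * δ * (d r * t' r) + δ ^ 2 * d r) := by
        have : ∀ q, d q * (t' + Pi.single r δ : ι → ℝ) q ^ 2
            = d q * t' q ^ 2 + (if q = r then (2 * δ * (d r * t' r) + δ ^ 2 * d r) else 0) := by
          intro q
          by_cases hqr : q = r
          · subst hqr; simp; ring
          · simp [hqr]
        simp only [this, Finset.sum_add_distrib, Finset.sum_ite_eq', Finset.mem_univ, if_true]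
      have e3 : ∑ i, ((∑ q, t' q * Y i q) + δ * Y i r) ^ 2
          = ∑ i, (∑ q, t' q * Y i q) ^ 2 + 2 * δ * ∑ i, (∑ q, t' q * Y i q) * Y i r
            + δ ^ 2 * ∑ i, Y i r ^ 2 := by
        rw [Finset.mul_sum, Finset.mul_sum, ← Finset.sum_add_distrib, ← Finset.sum_add_distrib]
        exact Finset.sum_congr rfl fun i _ => by ring
      simp only [e1]
      rw [e2, e3, Finset.sum_insert hr]
      linarith

/-- Randomised rounding for a quadratic form whose diagonal is bounded below: some lattice point
near `t` loses at most a quarter of the trace of the negative part. -/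
lemma exists_int_round {ι κ : Type*} [Fintype ι] [Fintype κ]
    (d : ι → ℝ) (hd : ∀ q, 0 ≤ d q) (Y : κ → ι → ℝ) (t : ι → ℝ) :
    ∃ k : ι → ℤ, (∀ q, |(k q : ℝ) - t q| ≤ 1) ∧
      ∑ q, d q * t q ^ 2 - ∑ i, (∑ q, t q * Y i q) ^ 2 ≤
        ∑ q, d q * (k q : ℝ) ^ 2 - ∑ i, (∑ q, (k q : ℝ) * Y i q) ^ 2
          + (∑ i, ∑ q, Y i q ^ 2) / 4 := by
  classical
  obtain ⟨t', h1, -, h3, h4⟩ := exists_round_finset d hd Y t Finset.univ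
  choose k hk using fun q => h1 q (Finset.mem_univ q)
  refine ⟨k, fun q => hk q ▸ h3 q, ?_⟩
  simp only [← hk]
  rwa [Finset.sum_comm] at h4

lemma sum_Icc_exp_neg_abs_le (N : ℕ) :
    ∑ j ∈ Finset.Icc (-(N : ℤ)) N, Real.exp (-|(j : ℝ)|) ≤ Real.exp 2 := by
  suffices h : ∑ j ∈ Finset.Icc (-(N : ℤ)) N, Real.exp (-|(j : ℝ)|)
      ≤ 3 - 2 * Real.exp (-(N : ℝ)) by
    linarith [Real.add_one_le_exp 2, Real.exp_pos (-(N : ℝ))]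
  induction N with
  | zero => norm_num
  | succ N ih =>
    have hS : Finset.Icc (-((N + 1 : ℕ) : ℤ)) ((N + 1 : ℕ) : ℤ)
        = insert ((N : ℤ) + 1) (insert (-((N : ℤ) + 1)) (Finset.Icc (-(N : ℤ)) N)) := by
      ext j
      simp only [Finset.mem_Icc, Finset.mem_insert]
      omega
    have ha : |(N : ℝ) + 1| = N + 1 := abs_of_nonneg (by positivity)
    rw [hS, Finset.sum_insert (by simp; omega), Finset.sum_insert (by simp)]
    push_cast
    rw [abs_neg, ha]
    have he : Real.exp (-((N : ℝ) + 1)) = Real.exp (-(N : ℝ)) * Real.exp (-1) := by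
      rw [← Real.exp_add]; congr 1; ring
    have h1 : Real.exp (-1) ≤ 1 / 2 := by linarith [Real.exp_neg_one_lt_d9]
    nlinarith [Real.exp_pos (-(N : ℝ))]

lemma sum_piFinset_exp_le (R N : ℕ) :
    ∑ k ∈ Fintype.piFinset fun _ : Fin R => Finset.Icc (-(N : ℤ)) N,
      Real.exp (-(∑ q, |(k q : ℝ)| + 2 * R)) ≤ 1 := by
  have h : ∑ k ∈ Fintype.piFinset fun _ : Fin R => Finset.Icc (-(N : ℤ)) N,
      ∏ q, Real.exp (-|(k q : ℝ)|) ≤ Real.exp (2 * R) := by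
    rw [← Finset.prod_univ_sum (fun _ : Fin R => Finset.Icc (-(N : ℤ)) N)
      fun _ j => Real.exp (-|(j : ℝ)|), Finset.prod_const, Finset.card_univ, Fintype.card_fin,
      mul_comm, Real.exp_nat_mul]
    exact pow_le_pow_left₀ (Finset.sum_nonneg fun _ _ => (Real.exp_pos _).le)
      (sum_Icc_exp_neg_abs_le N) R
  simp_rw [neg_add, Real.exp_add, ← Finset.sum_mul, ← Finset.sum_neg_distrib, Real.exp_sum]
  calc _ ≤ Real.exp (2 * R) * Real.exp (-(2 * R)) := by gcongr
    _ = 1 := by rw [← Real.exp_add]; simp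

lemma integral_sum_mul_sq_eq {X ι : Type*} [MeasurableSpace X] [Fintype ι] [DecidableEq ι]
    (μ : Measure X) (y : ι → X → ℝ) (p : ι → ℝ)
    (hyi : ∀ q q', Integrable (fun z => y q z * y q' z) μ)
    (hyp : ∀ q q', ∫ z, y q z * y q' z ∂μ = if q = q' then p q else 0) (a : ι → ℝ) :
    ∫ z, (∑ q, a q * y q z) ^ 2 ∂μ = ∑ q, p q * a q ^ 2 := by
  have h : ∀ z, (∑ q, a q * y q z) ^ 2 = ∑ q, ∑ q', a q * a q' * (y q z * y q' z) := fun z => by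
    rw [pow_two, Finset.sum_mul_sum]
    exact Finset.sum_congr rfl fun q _ => Finset.sum_congr rfl fun q' _ => by ring
  simp only [h]
  rw [integral_finsetSum _ fun q _ => integrable_finsetSum _ fun q' _ => (hyi q q').const_mul _]
  refine Finset.sum_congr rfl fun q _ => ?_
  rw [integral_finsetSum _ fun q' _ => (hyi q q').const_mul _]
  simp only [integral_const_mul, hyp, mul_ite, mul_zero, Finset.sum_ite_eq, Finset.mem_univ,
    if_true]
  ring

/-- Lower isometry with high probability for the quadratic form attached to an orthogonal family
of bounded functions. -/
lemma ofReal_le_measure_pi_quadratic {X : Type*} [MeasurableSpace X] (μ : Measure X)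
    [IsProbabilityMeasure μ] {R : ℕ} (n : ℕ) {x : ℝ} (hx : 0 < x)
    (y : Fin R → X → ℝ) (hy : ∀ q, Measurable (y q)) (p : Fin R → ℝ)
    (hyp : ∀ q q', ∫ z, y q z * y q' z ∂μ = if q = q' then p q else 0)
    (hp : ∀ q, n * p q ≤ 1) (hb : ∀ z, 1026 * (R + x) * ∑ q, y q z ^ 2 ≤ 1) :
    ENNReal.ofReal (1 - Real.exp (-x)) ≤ (Measure.pi fun _ : Fin n => μ)
      {xs | ∀ t : Fin R → ℝ, ∑ q, 9 / 16 * n * p q * t q ^ 2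
        - ∑ i, (∑ q, t q * y q (xs i)) ^ 2 ≤ (∑ q, t q ^ 2) / 16} := by
  rcases R.eq_zero_or_pos with rfl | hR
  · simp [(Real.exp_pos _).le]
  have hR1 : (1 : ℝ) ≤ R := by exact_mod_cast hR
  set L : ℝ := R + x with hL
  have hL1 : 1 ≤ L := by linarith
  have hp0 : ∀ q, 0 ≤ p q := fun q => by
    have := hyp q q
    rw [if_pos rfl] at this
    rw [← this]
    exact integral_nonneg fun z => mul_self_nonneg _
  have hs0 : ∀ z, 0 ≤ ∑ q, y q z ^ 2 := fun z => Finset.sum_nonneg fun _ _ => sq_nonneg _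
  have hs1 : ∀ z, ∑ q, y q z ^ 2 ≤ 1 := fun z => by nlinarith [hb z, hs0 z]
  have hy1 : ∀ q z, |y q z| ≤ 1 := fun q z => by
    rw [← sq_le_one_iff_abs_le_one]
    exact (Finset.single_le_sum (f := fun q => y q z ^ 2) (fun _ _ => sq_nonneg _)
      (Finset.mem_univ q)).trans (hs1 z)
  have hyi : ∀ q q', Integrable (fun z => y q z * y q' z) μ := fun q q' =>
    Integrable.of_bound ((hy q).mul (hy q')).aestronglyMeasurable 1 (.of_forall fun z => by
      rw [Real.norm_eq_abs, abs_mul]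
      exact mul_le_one₀ (hy1 q z) (abs_nonneg _) (hy1 q' z))
  set N : ℕ := ⌈1026 * L⌉₊
  set S := (Fintype.piFinset fun _ : Fin R => Finset.Icc (-(N : ℤ)) N).filter
    fun k => ∑ q, (k q : ℝ) ^ 2 ≤ 1026 * L
  set P := Measure.pi fun _ : Fin n => μ
  set bad : (Fin R → ℤ) → Set (Fin n → X) := fun k =>
    {xs | (x + 1) + (∑ q, |(k q : ℝ)| + 2 * R) ≤
      ∑ i, (9 / 16 * ∑ q, p q * (k q : ℝ) ^ 2 - (∑ q, (k q : ℝ) * y q (xs i)) ^ 2)}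
  set badT : Set (Fin n → X) :=
    {xs | x + 1 ≤ ∑ i, (∑ q, y q (xs i) ^ 2 - 2 * ∑ q, p q)}
  have hPk : ∀ k ∈ S, P.real (bad k) ≤
      Real.exp (-(x + 1)) * Real.exp (-(∑ q, |(k q : ℝ)| + 2 * R)) := by
    intro k hk
    rw [← Real.exp_add, ← neg_add]
    have hm : Measurable fun z => (∑ q, (k q : ℝ) * y q z) ^ 2 := by fun_prop
    have h1 : ∀ z, (∑ q, (k q : ℝ) * y q z) ^ 2 ≤ 1 := fun z => by
      have := Finset.sum_mul_sq_le_sq_mul_sq Finset.univ (fun q => (k q : ℝ)) fun q => y q z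
      have hk2 : ∑ q, (k q : ℝ) ^ 2 ≤ 1026 * L := (Finset.mem_filter.1 hk).2
      exact this.trans ((mul_le_mul_of_nonneg_right hk2 (hs0 z)).trans (hb z))
    have hint : ∑ q, p q * (k q : ℝ) ^ 2 ≤ ∫ z, (∑ q, (k q : ℝ) * y q z) ^ 2 ∂μ := by
      rw [integral_sum_mul_sq_eq μ y p hyi hyp]
    refine measureReal_pi_le_sum_le_exp_neg μ n ?_
      (integral_exp_sub_le_one μ hm (fun _ => sq_nonneg _) h1 hint) _
    simpa [sub_eq_add_neg] using integrable_exp_add_mul μ hm (fun _ => sq_nonneg _) h1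
      (9 / 16 * ∑ q, p q * (k q : ℝ) ^ 2) (-1)
  have hPT : P.real badT ≤ Real.exp (-(x + 1)) := by
    have hm : Measurable fun z => ∑ q, y q z ^ 2 := by fun_prop
    have hint : ∫ z, ∑ q, y q z ^ 2 ∂μ ≤ ∑ q, p q := by
      simp only [pow_two]
      rw [integral_finsetSum _ fun q _ => hyi q q]
      simp [hyp]
    refine measureReal_pi_le_sum_le_exp_neg μ n ?_
      (integral_exp_sub_two_mul_le_one μ hm hs0 hs1 hint) _
    simpa [sub_eq_add_neg, add_comm] using integrable_exp_add_mul μ hm hs0 hs1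
      (-(2 * ∑ q, p q)) 1
  have hPbad : P.real (badT ∪ ⋃ k ∈ S, bad k) ≤ Real.exp (-x) := by
    have h1 : P.real (⋃ k ∈ S, bad k) ≤ Real.exp (-(x + 1)) :=
      calc P.real (⋃ k ∈ S, bad k) ≤ ∑ k ∈ S, P.real (bad k) := measureReal_biUnion_finset_le S bad
        _ ≤ ∑ k ∈ S, Real.exp (-(x + 1)) * Real.exp (-(∑ q, |(k q : ℝ)| + 2 * R)) :=
          Finset.sum_le_sum hPk
        _ ≤ Real.exp (-(x + 1)) * 1 := by
          rw [← Finset.mul_sum]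
          gcongr
          exact (Finset.sum_le_sum_of_subset_of_nonneg (Finset.filter_subset _ _)
            fun _ _ _ => (Real.exp_pos _).le).trans (sum_piFinset_exp_le R N)
        _ = _ := mul_one _
    have h2 : Real.exp (-(x + 1)) = Real.exp (-x) * Real.exp (-1) := by
      rw [← Real.exp_add]; congr 1; ring
    have h3 : Real.exp (-1) ≤ 1 / 2 := by linarith [Real.exp_neg_one_lt_d9]
    have h4 := measureReal_union_le (μ := P) badT (⋃ k ∈ S, bad k)
    nlinarith [Real.exp_pos (-x)]
  have hmeas : MeasurableSet (badT ∪ ⋃ k ∈ S, bad k) := by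
    refine MeasurableSet.union ?_ (Finset.measurableSet_biUnion _ fun k _ => ?_)
    · exact measurableSet_le measurable_const (by fun_prop)
    · exact measurableSet_le measurable_const (by fun_prop)
  have hcompl : ENNReal.ofReal (1 - Real.exp (-x)) ≤ P (badT ∪ ⋃ k ∈ S, bad k)ᶜ := by
    rw [← ofReal_measureReal, probReal_compl_eq_one_sub hmeas]
    exact ENNReal.ofReal_le_ofReal (by linarith)
  refine hcompl.trans (measure_mono fun xs hxs => ?_)
  simp only [Set.mem_compl_iff, Set.mem_union, Set.mem_iUnion, not_or, not_exists] at hxs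
  obtain ⟨hxT, hxk⟩ := hxs
  have hT : ∑ i, ∑ q, y q (xs i) ^ 2 ≤ 3 * L := by
    have h1 : ¬ (x + 1 ≤ ∑ i, (∑ q, y q (xs i) ^ 2 - 2 * ∑ q, p q)) := hxT
    have h2 : n * ∑ q, p q ≤ R := by
      rw [Finset.mul_sum]
      exact (Finset.sum_le_sum fun q _ => hp q).trans (by simp)
    simp only [Finset.sum_sub_distrib, Finset.sum_const, Finset.card_univ, Fintype.card_fin,
      nsmul_eq_mul] at h1
    linarith
  have hZk : ∀ k ∈ S, ∑ q, 9 / 16 * n * p q * (k q : ℝ) ^ 2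
      - ∑ i, (∑ q, (k q : ℝ) * y q (xs i)) ^ 2 ≤ L + (∑ q, |(k q : ℝ)| + 2 * R) := by
    intro k hk
    have h1 : ¬ ((x + 1) + (∑ q, |(k q : ℝ)| + 2 * R) ≤
      ∑ i, (9 / 16 * ∑ q, p q * (k q : ℝ) ^ 2 - (∑ q, (k q : ℝ) * y q (xs i)) ^ 2)) := hxk k hk
    simp only [Finset.sum_sub_distrib, Finset.sum_const, Finset.card_univ, Fintype.card_fin,
      nsmul_eq_mul] at h1
    have h2 : ∑ q, 9 / 16 * n * p q * (k q : ℝ) ^ 2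
        = n * (9 / 16 * ∑ q, p q * (k q : ℝ) ^ 2) := by
      rw [Finset.mul_sum, Finset.mul_sum]
      exact Finset.sum_congr rfl fun q _ => by ring
    rw [h2]
    linarith
  have hsphere : ∀ t : Fin R → ℝ, ∑ q, t q ^ 2 = 512 * L →
      ∑ q, 9 / 16 * n * p q * t q ^ 2 - ∑ i, (∑ q, t q * y q (xs i)) ^ 2 ≤ 32 * L := by
    intro t ht
    obtain ⟨k, hkt, hk⟩ := exists_int_round (fun q => 9 / 16 * n * p q)
      (fun q => by have := hp0 q; positivity) (fun i q => y q (xs i)) t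
    have hk2 : ∑ q, (k q : ℝ) ^ 2 ≤ 1026 * L := by
      have : ∑ q, (k q : ℝ) ^ 2 ≤ ∑ q, (2 * t q ^ 2 + 2) := Finset.sum_le_sum fun q _ => by
        have := (sq_le_one_iff_abs_le_one _).2 (hkt q)
        nlinarith [sq_nonneg ((k q : ℝ) - 2 * t q)]
      simp only [Finset.sum_add_distrib, ← Finset.mul_sum, Finset.sum_const, Finset.card_univ,
        Fintype.card_fin, nsmul_eq_mul] at this
      linarith
    have hk1 : ∑ q, |(k q : ℝ)| ≤ 16 * L + 9 * R := by
      have : ∑ q, |(k q : ℝ)| ≤ ∑ q, (1 / 32 * t q ^ 2 + 9) := Finset.sum_le_sum fun q _ => by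
        have h1 := hkt q
        have h2 : |(k q : ℝ)| ≤ |(k q : ℝ) - t q| + |t q| := by
          simpa using abs_add_le ((k q : ℝ) - t q) (t q)
        nlinarith [sq_nonneg (|t q| - 16), sq_abs (t q)]
      simp only [Finset.sum_add_distrib, ← Finset.mul_sum, Finset.sum_const, Finset.card_univ,
        Fintype.card_fin, nsmul_eq_mul] at this
      linarith
    have hkS : k ∈ S := by
      refine Finset.mem_filter.2 ⟨Fintype.mem_piFinset.2 fun q => ?_, hk2⟩
      have h1 : |(k q : ℝ)| ≤ N := by
        have h2 : (k q : ℝ) ^ 2 ≤ 1026 * L :=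
          (Finset.single_le_sum (f := fun q => (k q : ℝ) ^ 2) (fun _ _ => sq_nonneg _)
            (Finset.mem_univ q)).trans hk2
        have h3 : |(k q : ℝ)| ≤ (k q : ℝ) ^ 2 := by
          rw [← Int.cast_abs, ← Int.cast_pow]
          rw [Int.cast_le, ← sq_abs, pow_two, Int.abs_eq_natAbs]
          exact_mod_cast Nat.le_mul_self (k q).natAbs
        exact (h3.trans h2).trans (Nat.le_ceil _)
      rw [Finset.mem_Icc, ← abs_le]
      exact_mod_cast h1
    have := hZk k hkS
    linarith
  intro t
  rcases (Finset.sum_nonneg fun q _ => sq_nonneg (t q) :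
    0 ≤ ∑ q, t q ^ 2).eq_or_lt' with h0 | hpos
  · have ht : ∀ q, t q = 0 := fun q => by
      simpa using (Finset.sum_eq_zero_iff_of_nonneg fun q _ => sq_nonneg (t q)).1 h0 q
        (Finset.mem_univ q)
    simp [ht]
  · set T := ∑ q, t q ^ 2 with hTdef
    set s := Real.sqrt (512 * L / T) with hs
    have hs2 : s ^ 2 = 512 * L / T := Real.sq_sqrt (by positivity)
    have h1 := hsphere (fun q => s * t q) (by
      simp only [mul_pow, ← Finset.mul_sum]
      rw [hs2, ← hTdef]
      field_simp)
    have h2 : ∑ q, 9 / 16 * n * p q * (s * t q) ^ 2 = s ^ 2 * ∑ q, 9 / 16 * n * p q * t q ^ 2 := by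
      rw [Finset.mul_sum]
      exact Finset.sum_congr rfl fun q _ => by ring
    have h3 : ∑ i, (∑ q, s * t q * y q (xs i)) ^ 2
        = s ^ 2 * ∑ i, (∑ q, t q * y q (xs i)) ^ 2 := by
      rw [Finset.mul_sum]
      refine Finset.sum_congr rfl fun i _ => ?_
      rw [← mul_pow, Finset.mul_sum]
      simp only [mul_assoc]
    rw [h2, h3, ← mul_sub] at h1
    have hs0 : 0 < s ^ 2 := by rw [hs2]; positivity
    refine le_of_mul_le_mul_left (h1.trans_eq ?_) hs0
    rw [hs2]
    field_simp
    norm_num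

/-- Generalization bound for the perturbed finite-rank RKHS ball: with orthonormal
`e₁,…,e_R` in `L²(μ)`, eigenvalues `λ₁ ≥ … ≥ λ_R > 0`, `κ ≥ sup_x Σ_q λ_q e_q(x)²`,
target `f* = Σ β*_q √λ_q e_q` with `Σ (β*_q)² ≤ γ₀²`, and `w ∈ (0,1)`, there is a constant `C`
depending only on `B, γ₀, κ` such that for every `n ≥ 1` and `x̄ > 0`, with probability at least
`1 − e^{−x̄}` over an i.i.d. sample, simultaneously for all `f = h + err ∈ F(B,w)` :
`∫ (f − f*)² dμ ≤ (2/n) Σᵢ (f(xᵢ) − f*(xᵢ))² + C (R/n + w + x̄/n)`. -/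
theorem finite_rank_generalization_bound (B γ₀ κ : ℝ) (hB : 0 < B) (hγ₀ : 0 < γ₀)
    (hκ : 0 < κ) :
    ∃ C > (0 : ℝ),
      ∀ (X : Type) (_ : MeasurableSpace X) (μ : Measure X), IsProbabilityMeasure μ →
      ∀ (R : ℕ) (e : Fin R → X → ℝ), (∀ q, Measurable (e q)) →
        (∀ q q', ∫ x, e q x * e q' x ∂μ = if q = q' then 1 else 0) →
      ∀ lam : Fin R → ℝ, (∀ q, 0 < lam q) → (∀ q q' : Fin R, q ≤ q' → lam q' ≤ lam q) →
        (∀ x : X, ∑ q, lam q * e q x ^ 2 ≤ κ) →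
      ∀ βs : Fin R → ℝ, (∑ q, βs q ^ 2) ≤ γ₀ ^ 2 →
      ∀ w : ℝ, 0 < w → w < 1 →
      ∀ n : ℕ, 1 ≤ n → ∀ xbar : ℝ, 0 < xbar →
        (Measure.pi fun _ : Fin n => μ)
            {xs : Fin n → X | ∀ (β : Fin R → ℝ) (err : X → ℝ),
              (∑ q, β q ^ 2) ≤ B ^ 2 → Measurable err → (∀ x, |err x| ≤ w) →
              ∫ x, ((∑ q, β q * Real.sqrt (lam q) * e q x + err x) -
                    ∑ q, βs q * Real.sqrt (lam q) * e q x) ^ 2 ∂μ ≤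
                (2 / n) * (∑ i : Fin n,
                    ((∑ q, β q * Real.sqrt (lam q) * e q (xs i) + err (xs i)) -
                      ∑ q, βs q * Real.sqrt (lam q) * e q (xs i)) ^ 2) +
                  C * (R / n + w + xbar / n)} ≥
          ENNReal.ofReal (1 - Real.exp (-xbar)) := by
  set A : ℝ := 2 * (B ^ 2 + γ₀ ^ 2) with hA
  have hA0 : 0 < A := by positivity
  have hκA : 0 < κ * A := by positivity
  refine ⟨6 * (1 + κ * A) + 1 + 129 * (κ * A), by positivity, ?_⟩
  intro X _ μ _ R e he horth lam hlam _ hbound βs hβs w hw hw1 n hn xbar hx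
  have hn0 : (0 : ℝ) < n := by exact_mod_cast hn
  set L : ℝ := R + xbar with hL
  have hL0 : 0 < L := by positivity
  set m : Fin R → ℝ := fun q => n * lam q + 1026 * κ * L with hm
  have hmpos : ∀ q, 0 < m q := fun q => by have := hlam q; positivity
  have hevent := ofReal_le_measure_pi_quadratic μ n hx
    (fun q z => Real.sqrt (lam q / m q) * e q z) (fun q => (he q).const_mul _)
    (fun q => lam q / m q) (fun q q' => by
      have h : ∀ z, Real.sqrt (lam q / m q) * e q z * (Real.sqrt (lam q' / m q') * e q' z)
          = Real.sqrt (lam q / m q) * Real.sqrt (lam q' / m q') * (e q z * e q' z) :=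
        fun z => by ring
      simp only [h]
      rw [integral_const_mul, horth]
      split_ifs with hqq
      · subst hqq
        rw [mul_one, Real.mul_self_sqrt (div_nonneg (hlam q).le (hmpos q).le)]
      · rw [mul_zero])
    (fun q => by
      rw [← mul_div_assoc, div_le_one (hmpos q)]
      have : 0 < 1026 * κ * L := by positivity
      simp only [hm]
      linarith)
    (fun z => by
      have h1 : ∑ q, (Real.sqrt (lam q / m q) * e q z) ^ 2
          ≤ ∑ q, (lam q * e q z ^ 2) / (1026 * κ * L) := Finset.sum_le_sum fun q _ => by
        rw [mul_pow, Real.sq_sqrt (div_nonneg (hlam q).le (hmpos q).le), div_mul_eq_mul_div]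
        refine div_le_div_of_nonneg_left (mul_nonneg (hlam q).le (sq_nonneg _)) (by positivity) ?_
        have := mul_pos hn0 (hlam q)
        simp only [hm]
        linarith
      rw [← Finset.sum_div] at h1
      calc 1026 * L * ∑ q, (Real.sqrt (lam q / m q) * e q z) ^ 2
          ≤ 1026 * L * (κ / (1026 * κ * L)) := by
            gcongr
            exact h1.trans (by gcongr; exact hbound z)
        _ = 1 := by field_simp)
  refine ge_iff_le.2 (hevent.trans (measure_mono fun xs hxs β err hβ herr herrw => ?_))
  set a : Fin R → ℝ := fun q => β q - βs q with ha
  set g : X → ℝ := fun z => ∑ q, a q * (Real.sqrt (lam q) * e q z) with hg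
  have haA : ∑ q, a q ^ 2 ≤ A := by
    have : ∑ q, a q ^ 2 ≤ ∑ q, (2 * β q ^ 2 + 2 * βs q ^ 2) := Finset.sum_le_sum fun q _ => by
      simp only [ha]
      nlinarith [sq_nonneg (β q + βs q)]
    simp only [Finset.sum_add_distrib, ← Finset.mul_sum] at this
    linarith
  have hfg : ∀ z, (∑ q, β q * Real.sqrt (lam q) * e q z + err z)
      - ∑ q, βs q * Real.sqrt (lam q) * e q z = g z + err z := fun z => by
    have : g z = ∑ q, β q * Real.sqrt (lam q) * e q z
        - ∑ q, βs q * Real.sqrt (lam q) * e q z := by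
      rw [← Finset.sum_sub_distrib]
      exact Finset.sum_congr rfl fun q _ => by simp only [ha]; ring
    rw [this]
    ring
  simp only [hfg]
  have hvκ : ∀ z, ∑ q, (Real.sqrt (lam q) * e q z) ^ 2 ≤ κ := fun z => by
    simpa only [mul_pow, Real.sq_sqrt (hlam _).le] using hbound z
  have hg2 : ∀ z, g z ^ 2 ≤ κ * A := fun z => by
    have := Finset.sum_mul_sq_le_sq_mul_sq Finset.univ a fun q => Real.sqrt (lam q) * e q z
    rw [mul_comm κ]
    exact this.trans (mul_le_mul haA (hvκ z) (Finset.sum_nonneg fun _ _ => sq_nonneg _) hA0.le)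
  have hgabs : ∀ z, |g z| ≤ 1 + κ * A := fun z =>
    abs_le.2 ⟨by nlinarith [hg2 z, sq_nonneg (g z + 1)], by nlinarith [hg2 z, sq_nonneg (g z - 1)]⟩
  have hgerr : ∀ z, |g z * err z| ≤ (1 + κ * A) * w := fun z => by
    rw [abs_mul]
    exact mul_le_mul (hgabs z) (herrw z) (abs_nonneg _) (by positivity)
  have herr2 : ∀ z, err z ^ 2 ≤ w := fun z => by
    have h := abs_le.1 (herrw z)
    nlinarith [sq_nonneg (err z)]
  have hgm : Measurable g := by fun_prop
  have hgi : Integrable (fun z => g z ^ 2) μ :=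
    Integrable.of_bound (by fun_prop) (κ * A) (.of_forall fun z => by
      rw [Real.norm_eq_abs, abs_of_nonneg (sq_nonneg _)]
      exact hg2 z)
  have hv1 : ∀ q z, |Real.sqrt (lam q) * e q z| ≤ Real.sqrt κ := fun q z =>
    Real.abs_le_sqrt ((Finset.single_le_sum
      (f := fun q => (Real.sqrt (lam q) * e q z) ^ 2) (fun _ _ => sq_nonneg _)
      (Finset.mem_univ q)).trans (hvκ z))
  have hgint : ∫ z, g z ^ 2 ∂μ = ∑ q, lam q * a q ^ 2 := by
    refine integral_sum_mul_sq_eq μ (fun q z => Real.sqrt (lam q) * e q z) lam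
      (fun q q' => ?_) (fun q q' => ?_) a
    · refine Integrable.of_bound (((he q).const_mul _).mul ((he q').const_mul _)).aestronglyMeasurable
        (Real.sqrt κ * Real.sqrt κ) (.of_forall fun z => ?_)
      rw [Real.norm_eq_abs, abs_mul]
      exact mul_le_mul (hv1 q z) (hv1 q' z) (abs_nonneg _) (Real.sqrt_nonneg _)
    · have h : ∀ z, Real.sqrt (lam q) * e q z * (Real.sqrt (lam q') * e q' z)
          = Real.sqrt (lam q) * Real.sqrt (lam q') * (e q z * e q' z) := fun z => by ring
      simp only [h]
      rw [integral_const_mul, horth]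
      split_ifs with hqq
      · subst hqq
        rw [mul_one, Real.mul_self_sqrt (hlam q).le]
      · rw [mul_zero]
  have hupper : ∫ z, (g z + err z) ^ 2 ∂μ
      ≤ ∑ q, lam q * a q ^ 2 + (2 * ((1 + κ * A) * w) + w) := by
    rw [← hgint]
    calc ∫ z, (g z + err z) ^ 2 ∂μ ≤ ∫ z, (g z ^ 2 + (2 * ((1 + κ * A) * w) + w)) ∂μ := by
          have hle : ∀ z, (g z + err z) ^ 2 ≤ g z ^ 2 + (2 * ((1 + κ * A) * w) + w) := fun z => by
            nlinarith [(abs_le.1 (hgerr z)).2, herr2 z]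
          refine integral_mono ?_ (hgi.add (integrable_const _)) hle
          refine Integrable.of_bound (by fun_prop) (κ * A + (2 * ((1 + κ * A) * w) + w))
            (.of_forall fun z => ?_)
          rw [Real.norm_eq_abs, abs_of_nonneg (sq_nonneg _)]
          linarith [hle z, hg2 z]
      _ = _ := by
          rw [integral_add hgi (integrable_const _)]
          simp
  have hlower : ∑ i, g (xs i) ^ 2
      ≤ ∑ i, (g (xs i) + err (xs i)) ^ 2 + n * (2 * ((1 + κ * A) * w)) := by
    have : ∑ i, g (xs i) ^ 2
        ≤ ∑ i, ((g (xs i) + err (xs i)) ^ 2 + 2 * ((1 + κ * A) * w)) :=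
      Finset.sum_le_sum fun i _ => by
        nlinarith [(abs_le.1 (hgerr (xs i))).1, sq_nonneg (err (xs i))]
    simpa only [Finset.sum_add_distrib, Finset.sum_const, Finset.card_univ, Fintype.card_fin,
      nsmul_eq_mul] using this
  have hquad := hxs fun q => Real.sqrt (m q) * a q
  have hq1 : ∑ q, 9 / 16 * n * (lam q / m q) * (Real.sqrt (m q) * a q) ^ 2
      = 9 / 16 * (n * ∑ q, lam q * a q ^ 2) := by
    rw [Finset.mul_sum, Finset.mul_sum]
    refine Finset.sum_congr rfl fun q _ => ?_
    have := (hmpos q).ne'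
    rw [mul_pow, Real.sq_sqrt (hmpos q).le]
    field_simp
  have hq2 : ∀ z, ∑ q, Real.sqrt (m q) * a q * (Real.sqrt (lam q / m q) * e q z) = g z :=
    fun z => Finset.sum_congr rfl fun q _ => by
      have := (Real.sqrt_pos.2 (hmpos q)).ne'
      rw [Real.sqrt_div (hlam q).le]
      field_simp
  have hq3 : ∑ q, (Real.sqrt (m q) * a q) ^ 2
      = n * ∑ q, lam q * a q ^ 2 + 1026 * κ * L * ∑ q, a q ^ 2 := by
    rw [Finset.mul_sum, Finset.mul_sum, ← Finset.sum_add_distrib]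
    refine Finset.sum_congr rfl fun q _ => ?_
    rw [mul_pow, Real.sq_sqrt (hmpos q).le]
    simp only [hm]
    ring
  simp only [hq1, hq2, hq3] at hquad
  have hLA : 1026 * κ * L * ∑ q, a q ^ 2 ≤ 1026 * κ * L * A := by gcongr
  have hmain : ∑ q, lam q * a q ^ 2 ≤ (2 / n) * (∑ i, (g (xs i) + err (xs i)) ^ 2)
      + 4 * ((1 + κ * A) * w) + 129 * (κ * A) * (L / n) := by
    rw [← mul_le_mul_iff_right₀ hn0]
    have h1 : n * ((2 / n) * (∑ i, (g (xs i) + err (xs i)) ^ 2)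
        + 4 * ((1 + κ * A) * w) + 129 * (κ * A) * (L / n))
        = 2 * (∑ i, (g (xs i) + err (xs i)) ^ 2)
        + n * (4 * ((1 + κ * A) * w)) + 129 * (κ * A) * L := by
      field_simp
    rw [h1]
    have h2 : 0 < κ * A * L := by positivity
    linarith
  have hLn : (R : ℝ) / n + w + xbar / n = L / n + w := by rw [hL]; ring
  rw [hLn]
  have h1 : 0 ≤ (6 * (1 + κ * A) + 1) * (L / n) := by positivity
  have h2 : 0 ≤ 129 * (κ * A) * w := by positivity
  linarith
end

section
/- (Bounded RKHS norm of the noise component along gradient descent.) Let K_n ∈ ℝ^{n×n} be symmetric positive semidefinite with spectral decomposition K_n = U diag(λ̂₁,…,λ̂ₙ) Uᵀ, eigenvalues λ̂₁ ≥ … ≥ λ̂ₙ ≥ 0, let σ₀ > 0, and let ε̂ₙ be the empirical critical radius of (K_n, σ₀). Let η > 0 satisfy η λ̂₁ ≤ 1 and fix an integer t ≥ 1 with η t ≤ 1/ε̂ₙ². Let w ∈ ℝⁿ be a random vector with independent mean-zero σ₀²-sub-Gaussian coordinates. Then there is a constant c > 0 depending only on σ₀ such that with probability at least 1 − exp(−c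 n ε̂ₙ²): (1/n) Σ_{i: λ̂_i > 0} ( (1 − (1 − η λ̂_i)^t)² / λ̂_i ) · [Uᵀ w]_i² ≤ 2. -/
open MeasureTheory Matrix

/-- The empirical kernel complexity `R̂(ε) := √((1/n) Σ_i min{λ̂ᵢ, ε²})`. -/
noncomputable def empKernelComplexity (n : ℕ) (lam : Fin n → ℝ) (ε : ℝ) : ℝ :=
  Real.sqrt ((n : ℝ)⁻¹ * ∑ i, min (lam i) (ε ^ 2))

/-- `εn` is the empirical critical radius of `(K_n, σ₀)`: the smallest `ε > 0` with
`σ₀ R̂(ε) ≤ ε²`. -/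
def IsEmpCriticalRadius (n : ℕ) (lam : Fin n → ℝ) (σ₀ εn : ℝ) : Prop :=
  0 < εn ∧ σ₀ * empKernelComplexity n lam εn ≤ εn ^ 2 ∧
    ∀ ε : ℝ, 0 < ε → σ₀ * empKernelComplexity n lam ε ≤ ε ^ 2 → εn ≤ ε

open ProbabilityTheory in
theorem lintegral_exp_mul_gaussianReal (a : ℝ) :
    ∫⁻ s, ENNReal.ofReal (Real.exp (a * s)) ∂gaussianReal 0 1 =
      ENNReal.ofReal (Real.exp (a ^ 2 / 2)) := by
  rw [← ofReal_integral_eq_lintegral_ofReal (integrable_exp_mul_gaussianReal a)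
    (ae_of_all _ fun _ => (Real.exp_pos _).le)]
  have h := congrFun (mgf_fun_id_gaussianReal (μ := 0) (v := 1)) a
  simp only [mgf, zero_mul, zero_add, NNReal.coe_one, one_mul] at h
  rw [h]

open ProbabilityTheory in
theorem lintegral_exp_mul_sq_gaussianReal {x : ℝ} (hx : x < 1) :
    ∫⁻ s, ENNReal.ofReal (Real.exp (x / 2 * s ^ 2)) ∂gaussianReal 0 1 =
      ENNReal.ofReal (Real.sqrt (1 / (1 - x))) := by
  have hb : 0 < (1 - x) / 2 := by linarith
  have h1x : (1 - x) ≠ 0 := by linarith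
  rw [gaussianReal_of_var_ne_zero _ one_ne_zero, lintegral_withDensity_eq_lintegral_mul _
    (measurable_gaussianPDF 0 1) (by fun_prop)]
  have h : ∀ s : ℝ, (gaussianPDF 0 1 * fun s => ENNReal.ofReal (Real.exp (x / 2 * s ^ 2))) s =
      ENNReal.ofReal ((Real.sqrt (2 * Real.pi))⁻¹ * Real.exp (-((1 - x) / 2) * s ^ 2)) := by
    intro s
    rw [Pi.mul_apply, gaussianPDF_def, ← ENNReal.ofReal_mul (gaussianPDFReal_nonneg _ _ _),
      gaussianPDFReal_def]
    simp only [NNReal.coe_one, mul_one, sub_zero]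
    rw [mul_assoc, ← Real.exp_add]
    ring_nf
  rw [lintegral_congr h, ← ofReal_integral_eq_lintegral_ofReal
    ((integrable_exp_neg_mul_sq hb).const_mul _) (ae_of_all _ fun _ => by positivity),
    integral_const_mul, integral_gaussian, ← Real.sqrt_inv, ← Real.sqrt_mul (by positivity)]
  congr 2
  have := Real.pi_ne_zero
  field_simp

theorem sqrt_one_div_one_sub_le_exp {x : ℝ} (h0 : 0 ≤ x) (hx : x ≤ 1 / 4) :
    Real.sqrt (1 / (1 - x)) ≤ Real.exp (2 / 3 * x) := by
  have h1 : 0 < 1 - x := by linarith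
  rw [Real.sqrt_le_left (Real.exp_pos _).le, ← Real.exp_nat_mul]
  have h2 : 1 / (1 - x) ≤ 1 + 4 / 3 * x := by
    rw [div_le_iff₀ h1]
    nlinarith
  calc 1 / (1 - x) ≤ 4 / 3 * x + 1 := by linarith
    _ ≤ Real.exp (4 / 3 * x) := Real.add_one_le_exp _
    _ = _ := by push_cast; ring_nf

theorem lintegral_pi_exp_sum {ι : Type*} [Fintype ι] (ν : ι → Measure ℝ)
    [∀ i, IsProbabilityMeasure (ν i)] (f : ι → ℝ → ℝ) (hf : ∀ i, Measurable (f i)) :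
    ∫⁻ w, ENNReal.ofReal (Real.exp (∑ i, f i (w i))) ∂Measure.pi ν =
      ∏ i, ∫⁻ s, ENNReal.ofReal (Real.exp (f i s)) ∂ν i := by
  have hm : ∀ i, Measurable fun s => ENNReal.ofReal (Real.exp (f i s)) := by fun_prop
  have hind := ProbabilityTheory.iIndepFun_pi (μ := ν) fun i => (hm i).aemeasurable
  have h := ProbabilityTheory.lintegral_prod_eq_prod_lintegral_of_indepFun Finset.univ _ hind
    fun i => (hm i).comp (measurable_pi_apply i)
  simp_rw [Real.exp_sum, ENNReal.ofReal_prod_of_nonneg fun i _ => (Real.exp_pos _).le]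
  rw [h]
  refine Finset.prod_congr rfl fun i _ => ?_
  exact (measurePreserving_eval ν i).lintegral_comp (hm i)

/-- Exponential moment of a quadratic form in independent sub-Gaussian variables, by decoupling
with an independent standard Gaussian vector. -/
theorem lintegral_exp_quadratic_le {ι : Type*} [Fintype ι] [DecidableEq ι] {σ : ℝ}
    {ν : ι → Measure ℝ} [∀ i, IsProbabilityMeasure (ν i)]
    (hν : ∀ i l, ∫⁻ s, ENNReal.ofReal (Real.exp (l * s)) ∂ν i ≤
      ENNReal.ofReal (Real.exp (l ^ 2 * σ ^ 2 / 2)))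
    {U : Matrix ι ι ℝ} (hU : Uᵀ * U = 1) {a : ι → ℝ} (ha : ∀ i, 0 ≤ a i)
    (ha' : ∀ i, σ ^ 2 * a i ≤ 1 / 4) :
    ∫⁻ w, ENNReal.ofReal (Real.exp (∑ i, a i / 2 * (Uᵀ.mulVec w i) ^ 2)) ∂Measure.pi ν ≤
      ENNReal.ofReal (Real.exp (2 / 3 * (σ ^ 2 * ∑ i, a i))) := by
  set γ : ι → Measure ℝ := fun _ => ProbabilityTheory.gaussianReal 0 1
  set b : ι → ℝ := fun i => Real.sqrt (a i)
  have hb : ∀ i, b i ^ 2 = a i := fun i => Real.sq_sqrt (ha i)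
  have hdec : ∀ w : ι → ℝ,
      ENNReal.ofReal (Real.exp (∑ i, a i / 2 * (Uᵀ.mulVec w i) ^ 2)) =
        ∫⁻ g, ENNReal.ofReal (Real.exp (∑ i, b i * Uᵀ.mulVec w i * g i)) ∂Measure.pi γ := by
    intro w
    rw [lintegral_pi_exp_sum γ (fun i s => b i * Uᵀ.mulVec w i * s) (by fun_prop), Real.exp_sum,
      ENNReal.ofReal_prod_of_nonneg fun i _ => (Real.exp_pos _).le]
    refine Finset.prod_congr rfl fun i _ => ?_
    rw [lintegral_exp_mul_gaussianReal, mul_pow, hb]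
    ring_nf
  have hswap : ∀ w g : ι → ℝ, ∑ i, b i * Uᵀ.mulVec w i * g i =
      ∑ j, U.mulVec (fun i => b i * g i) j * w j := by
    intro w g
    calc ∑ i, b i * Uᵀ.mulVec w i * g i = (fun i => b i * g i) ⬝ᵥ Uᵀ.mulVec w :=
          Finset.sum_congr rfl fun i _ => by ring
      _ = U.mulVec (fun i => b i * g i) ⬝ᵥ w := by
          rw [dotProduct_mulVec, vecMul_transpose]
      _ = _ := rfl
  have hnorm : ∀ g : ι → ℝ, ∑ j, U.mulVec (fun i => b i * g i) j ^ 2 = ∑ i, a i * g i ^ 2 := by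
    intro g
    calc ∑ j, U.mulVec (fun i => b i * g i) j ^ 2
        = U.mulVec (fun i => b i * g i) ⬝ᵥ U.mulVec (fun i => b i * g i) :=
          Finset.sum_congr rfl fun i _ => by ring
      _ = (fun i => b i * g i) ⬝ᵥ (fun i => b i * g i) := by
          rw [dotProduct_mulVec, ← mulVec_transpose, mulVec_mulVec, hU, one_mulVec]
      _ = _ := Finset.sum_congr rfl fun i _ => by rw [← hb]; ring
  have hmeas : Measurable (Function.uncurry fun w g : ι → ℝ =>
      ENNReal.ofReal (Real.exp (∑ i, b i * Uᵀ.mulVec w i * g i))) := by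
    simp only [Function.uncurry_def, mulVec, dotProduct]
    fun_prop
  have hinner : ∀ g : ι → ℝ,
      ∫⁻ w, ENNReal.ofReal (Real.exp (∑ i, b i * Uᵀ.mulVec w i * g i)) ∂Measure.pi ν ≤
        ENNReal.ofReal (Real.exp (∑ i, σ ^ 2 * a i / 2 * g i ^ 2)) := by
    intro g
    simp_rw [hswap]
    rw [lintegral_pi_exp_sum ν (fun j s => U.mulVec (fun i => b i * g i) j * s) (by fun_prop)]
    calc _ ≤ ∏ j, ENNReal.ofReal
          (Real.exp (U.mulVec (fun i => b i * g i) j ^ 2 * σ ^ 2 / 2)) :=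
          Finset.prod_le_prod' fun j _ => hν j _
      _ = _ := by
          rw [← ENNReal.ofReal_prod_of_nonneg fun i _ => (Real.exp_pos _).le, ← Real.exp_sum,
            ← Finset.sum_div, ← Finset.sum_mul, hnorm, Finset.sum_mul, Finset.sum_div]
          congr 2
          exact Finset.sum_congr rfl fun i _ => by ring
  calc _ = ∫⁻ w, ∫⁻ g, ENNReal.ofReal (Real.exp (∑ i, b i * Uᵀ.mulVec w i * g i))
          ∂Measure.pi γ ∂Measure.pi ν := lintegral_congr hdec
    _ = ∫⁻ g, ∫⁻ w, ENNReal.ofReal (Real.exp (∑ i, b i * Uᵀ.mulVec w i * g i))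
          ∂Measure.pi ν ∂Measure.pi γ := lintegral_lintegral_swap hmeas.aemeasurable
    _ ≤ ∫⁻ g, ENNReal.ofReal (Real.exp (∑ i, σ ^ 2 * a i / 2 * g i ^ 2)) ∂Measure.pi γ :=
        lintegral_mono hinner
    _ = ∏ i, ∫⁻ s, ENNReal.ofReal (Real.exp (σ ^ 2 * a i / 2 * s ^ 2)) ∂γ i :=
        lintegral_pi_exp_sum γ (fun i s => σ ^ 2 * a i / 2 * s ^ 2) (by fun_prop)
    _ ≤ ∏ i, ENNReal.ofReal (Real.exp (2 / 3 * (σ ^ 2 * a i))) := by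
        refine Finset.prod_le_prod' fun i _ => ?_
        rw [lintegral_exp_mul_sq_gaussianReal (by linarith [ha' i])]
        exact ENNReal.ofReal_le_ofReal
          (sqrt_one_div_one_sub_le_exp (mul_nonneg (sq_nonneg _) (ha i)) (ha' i))
    _ = _ := by
        rw [← ENNReal.ofReal_prod_of_nonneg fun i _ => (Real.exp_pos _).le, ← Real.exp_sum,
          Finset.mul_sum, Finset.mul_sum]

/-- The gradient-descent spectral weight is at most `min(λ, ε²) / ε⁴` once `η t ≤ 1 / ε²`. -/
theorem gd_weight_le {x η ε : ℝ} {t : ℕ} (hx : 0 ≤ x) (hη : 0 < η) (hηx : η * x ≤ 1)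
    (hε : 0 < ε) (ht : η * t ≤ 1 / ε ^ 2) :
    (1 - (1 - η * x) ^ t) ^ 2 / x ≤ min x (ε ^ 2) / ε ^ 4 := by
  rcases hx.eq_or_lt with rfl | hx
  · simp [sq_nonneg]
  have hε2 : 0 < ε ^ 2 := by positivity
  have hnonneg : 0 ≤ η * x := by positivity
  set p := 1 - (1 - η * x) ^ t with hp
  have hp0 : 0 ≤ p := sub_nonneg.2 (pow_le_one₀ (by linarith) (by linarith))
  have hp1 : p ≤ 1 := sub_le_self _ (pow_nonneg (by linarith) _)
  have hpt : p ≤ x / ε ^ 2 := by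
    have h := one_add_mul_le_pow (a := -(η * x)) (by linarith) t
    rw [← sub_eq_add_neg] at h
    calc p ≤ η * t * x := by linarith
      _ ≤ 1 / ε ^ 2 * x := by gcongr
      _ = x / ε ^ 2 := by ring
  rw [div_le_div_iff₀ hx (by positivity)]
  rw [le_div_iff₀ hε2] at hpt
  have hmin : p * ε ^ 2 ≤ min x (ε ^ 2) := le_min hpt (by nlinarith)
  calc p ^ 2 * ε ^ 4 = (p * ε ^ 2) * (p * ε ^ 2) := by ring
    _ ≤ min x (ε ^ 2) * x := by gcongr

/-- Bounded RKHS norm of the noise component along gradient descent: with `K_n = U diag(λ̂) Uᵀ`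
PSD, `η λ̂₁ ≤ 1`, `1 ≤ t` and `η t ≤ 1/ε̂ₙ²`, and `w` with independent mean-zero
`σ₀²`-sub-Gaussian coordinates, there is `c > 0` depending only on `σ₀` such that with
probability at least `1 − exp(−c n ε̂ₙ²)`:
`(1/n) Σ_{λ̂_i>0} ((1 − (1 − η λ̂_i)^t)²/λ̂_i) [Uᵀw]_i² ≤ 2`. -/
theorem gd_noise_rkhs_norm_bound (σ₀ : ℝ) (hσ₀ : 0 < σ₀) :
    ∃ c > (0 : ℝ),
      ∀ (n : ℕ) (hn : 0 < n) (U Kn : Matrix (Fin n) (Fin n) ℝ) (lam : Fin n → ℝ)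
        (η εn : ℝ),
        U * Uᵀ = 1 → Uᵀ * U = 1 →
        Kn = U * Matrix.diagonal lam * Uᵀ →
        (∀ i, 0 ≤ lam i) → (∀ i j : Fin n, i ≤ j → lam j ≤ lam i) →
        IsEmpCriticalRadius n lam σ₀ εn →
        0 < η → η * lam ⟨0, hn⟩ ≤ 1 →
      ∀ t : ℕ, 1 ≤ t → η * t ≤ 1 / εn ^ 2 →
      ∀ (ν : Fin n → Measure ℝ), (∀ i, IsProbabilityMeasure (ν i)) →
        (∀ (i : Fin n) (l : ℝ),
          Integrable (fun s => Real.exp (l * s)) (ν i) ∧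
            ∫ s, Real.exp (l * s) ∂(ν i) ≤ Real.exp (l ^ 2 * σ₀ ^ 2 / 2)) →
        (Measure.pi ν)
            {w : Fin n → ℝ |
              (n : ℝ)⁻¹ *
                  ∑ i ∈ Finset.univ.filter fun i => lam i ≠ 0,
                    ((1 - (1 - η * lam i) ^ t) ^ 2 / lam i) * (Uᵀ.mulVec w i) ^ 2 ≤ 2} ≥
          ENNReal.ofReal (1 - Real.exp (-(c * n * εn ^ 2))) := by
  refine ⟨1 / (12 * σ₀ ^ 2), by positivity, ?_⟩
  intro n hn U Kn lam η ε _ hU _ hlam hmono hε hη hη1 t _ ht ν hprob hsub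
  obtain ⟨hε0, hcrit, -⟩ := hε
  have hn0 : (0 : ℝ) < n := by exact_mod_cast hn
  set d : Fin n → ℝ := fun i => (1 - (1 - η * lam i) ^ t) ^ 2 / lam i with hd
  have hd0 : ∀ i, 0 ≤ d i := fun i => div_nonneg (sq_nonneg _) (hlam i)
  have hdle : ∀ i, d i ≤ min (lam i) (ε ^ 2) / ε ^ 4 := fun i =>
    gd_weight_le (hlam i) hη
      ((mul_le_mul_of_nonneg_left (hmono ⟨0, hn⟩ i (Nat.zero_le _)) hη.le).trans hη1) hε0 ht
  have hdop : ∀ i, d i * ε ^ 2 ≤ 1 := fun i => by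
    have h := (hdle i).trans
      (div_le_div_of_nonneg_right (min_le_right _ _) (by positivity : 0 ≤ ε ^ 4))
    calc d i * ε ^ 2 ≤ ε ^ 2 / ε ^ 4 * ε ^ 2 := by gcongr
      _ = 1 := by field_simp
  have htrace : σ₀ ^ 2 * ∑ i, d i ≤ n := by
    have hsum : 0 ≤ ∑ i, min (lam i) (ε ^ 2) :=
      Finset.sum_nonneg fun i _ => le_min (hlam i) (sq_nonneg _)
    have h : (σ₀ * empKernelComplexity n lam ε) ^ 2 ≤ (ε ^ 2) ^ 2 :=
      pow_le_pow_left₀ (mul_nonneg hσ₀.le (Real.sqrt_nonneg _)) hcrit 2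
    rw [mul_pow, empKernelComplexity, Real.sq_sqrt (by positivity), ← pow_mul] at h
    calc σ₀ ^ 2 * ∑ i, d i ≤ σ₀ ^ 2 * ∑ i, min (lam i) (ε ^ 2) / ε ^ 4 := by
          gcongr with i; exact hdle i
      _ = n * (σ₀ ^ 2 * ((n : ℝ)⁻¹ * ∑ i, min (lam i) (ε ^ 2))) / ε ^ 4 := by
          rw [← Finset.sum_div]; field_simp
      _ ≤ n * ε ^ (2 * 2) / ε ^ 4 := by gcongr
      _ = n := by norm_num; field_simp
  set s : ℝ := ε ^ 2 / (8 * σ₀ ^ 2) with hs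
  have hs0 : 0 < s := by positivity
  have hmgf := lintegral_exp_quadratic_le (σ := σ₀) (ν := ν)
    (fun i l => by
      rw [← ofReal_integral_eq_lintegral_ofReal (hsub i l).1
        (ae_of_all _ fun _ => (Real.exp_pos _).le)]
      exact ENNReal.ofReal_le_ofReal (hsub i l).2) hU (a := fun i => 2 * s * d i)
    (fun i => mul_nonneg (by positivity) (hd0 i))
    (fun i => by
      have : σ₀ ^ 2 * (2 * s * d i) = d i * ε ^ 2 / 4 := by rw [hs]; field_simp; ring
      linarith [hdop i])
  set Q : (Fin n → ℝ) → ℝ := fun w => (n : ℝ)⁻¹ *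
    ∑ i ∈ Finset.univ.filter fun i => lam i ≠ 0, d i * (Uᵀ.mulVec w i) ^ 2 with hQ
  have hQm : Measurable Q := by
    simp only [hQ, mulVec, dotProduct]
    fun_prop
  have hQexp : ∀ w, ∑ i, 2 * s * d i / 2 * (Uᵀ.mulVec w i) ^ 2 = s * n * Q w := by
    intro w
    have h : ∑ i ∈ Finset.univ.filter (fun i => lam i ≠ 0), d i * (Uᵀ.mulVec w i) ^ 2 =
        ∑ i, d i * (Uᵀ.mulVec w i) ^ 2 :=
      Finset.sum_filter_of_ne fun i _ hne h0 => hne (by simp [hd, h0])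
    simp only [hQ, h]
    rw [mul_assoc, mul_inv_cancel_left₀ hn0.ne', Finset.mul_sum]
    exact Finset.sum_congr rfl fun i _ => by ring
  simp_rw [hQexp] at hmgf
  have htail : Measure.pi ν {w | Q w ≤ 2}ᶜ ≤
      ENNReal.ofReal (Real.exp (-(1 / (12 * σ₀ ^ 2) * n * ε ^ 2))) := by
    have hmarkov := meas_ge_le_lintegral_div (μ := Measure.pi ν)
      (f := fun w => ENNReal.ofReal (Real.exp (s * n * Q w))) (by fun_prop)
      (ε := ENNReal.ofReal (Real.exp (s * n * 2))) (by simp [Real.exp_pos]) ENNReal.ofReal_ne_top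
    calc Measure.pi ν {w | Q w ≤ 2}ᶜ
        ≤ Measure.pi ν {w | ENNReal.ofReal (Real.exp (s * n * 2)) ≤
            ENNReal.ofReal (Real.exp (s * n * Q w))} := by
          refine measure_mono fun w hw => ?_
          have hw : 2 < Q w := not_le.1 hw
          simp only [Set.mem_ofPred_eq]
          gcongr
      _ ≤ _ := hmarkov
      _ ≤ _ := ENNReal.div_le_div_right hmgf _
      _ ≤ _ := by
          rw [← ENNReal.ofReal_div_of_pos (Real.exp_pos _), ← Real.exp_sub]
          refine ENNReal.ofReal_le_ofReal (Real.exp_le_exp.2 ?_)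
          have h1 : σ₀ ^ 2 * ∑ i, 2 * s * d i ≤ 2 * s * n := by
            rw [← Finset.mul_sum]
            nlinarith
          have h2 : 1 / (12 * σ₀ ^ 2) * n * ε ^ 2 = 2 / 3 * (s * n) := by
            rw [hs]; field_simp; norm_num
          linarith
  have hS : MeasurableSet {w | Q w ≤ 2} := measurableSet_le hQm measurable_const
  rw [ge_iff_le, ENNReal.ofReal_sub _ (Real.exp_pos _).le, ENNReal.ofReal_one,
    tsub_le_iff_right]
  calc (1 : ENNReal) = Measure.pi ν {w | Q w ≤ 2} + Measure.pi ν {w | Q w ≤ 2}ᶜ := by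
        rw [measure_add_measure_compl hS, measure_univ]
    _ ≤ _ := by gcongr
end
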